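/- arXiv:2208.14712 — 3 statements merged into one kernel-verified Lean document; each statement's English description precedes it below -/
import Mathlib

section
/- Let k be a field, A a finite-dimensional self-injective k-algebra, and M a finitely generated A-module that is a generator, self-orthogonal and Nakayama-stable. Then M is a projective A-module if and only if every module in 𝒢 is a filtered colimit (colimit of a functor from a small filtered category to A-Mod) of finitely generated modules lying in 𝒢; that is, 𝒢 coincides with the class of all filtered colimits of modules in 𝒢₀. (Theorem 1.2, equivalence of (1) and (2).) -/
open CategoryTheory
/-! ## Additive closure classes -/

section AddClosure

variable (A : Type) [Ring A]

/-- `X ∈ add M`: `X` is a direct summand of a finite direct sum of copies of `M`. -/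
def MemAdd (M X : ModuleCat.{0} A) : Prop :=
  ∃ (n : ℕ) (Y : ModuleCat.{0} A), Nonempty ((↥X × ↥Y) ≃ₗ[A] (Fin n → ↥M))

/-- `X ∈ Add M`: `X` is a direct summand of an arbitrary direct sum of copies of `M`. -/
def MemAddBig (M X : ModuleCat.{0} A) : Prop :=
  ∃ (I : Type) (Y : ModuleCat.{0} A), Nonempty ((↥X × ↥Y) ≃ₗ[A] (I →₀ ↥M))

/-- a morphism of `A`-modules factors through a projective module -/
def FactorsThroughProj {X Y : ModuleCat.{0} A} (f : X ⟶ Y) : Prop :=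
  ∃ (P : ModuleCat.{0} A) (_ : Module.Projective A P) (g : X ⟶ P) (h : P ⟶ Y), f = g ≫ h

/-- a morphism of `A`-modules factors through a module in `Add M` -/
def FactorsThroughAddM (M : ModuleCat.{0} A) {X Y : ModuleCat.{0} A} (f : X ⟶ Y) : Prop :=
  ∃ (Z : ModuleCat.{0} A) (_ : MemAddBig A M Z) (g : X ⟶ Z) (h : Z ⟶ Y), f = g ≫ h

/-- `X ∈ add M` for unbundled modules. -/
def MemAddPlain (M : Type) [AddCommGroup M] [Module A M]
    (X : Type) [AddCommGroup X] [Module A X] : Prop :=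
  ∃ (n : ℕ) (Y : ModuleCat.{0} A), Nonempty ((X × ↥Y) ≃ₗ[A] (Fin n → M))

end AddClosure

/-! ## Ext vanishing -/

section ExtDefs

variable (A : Type) [Ring A]

/-- vanishing of `Ext^n_A(X, Y)` -/
noncomputable def extZero (n : ℕ) (X Y : ModuleCat.{0} A) : Prop :=
  Subsingleton (((Ext ℤ (ModuleCat.{0} A) n).obj (Opposite.op X)).obj Y)

/-- `M` is self-orthogonal: `Ext^n_A(M,M) = 0` for all `n ≥ 1`. -/
noncomputable def SelfOrthogonal (M : ModuleCat.{0} A) : Prop :=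
  ∀ n : ℕ, 1 ≤ n → extZero A n M M

/-- `M` is a generator for `A`-mod: `A ∈ add M`. -/
def IsGen (M : ModuleCat.{0} A) : Prop :=
  MemAdd A M (ModuleCat.of A A)

/-- membership in the `M`-Gorenstein subcategory `𝒢`:
`Ext^n_A(M,X) = 0 = Ext^n_A(X,M)` for all `n ≥ 1`. -/
noncomputable def MemG (M X : ModuleCat.{0} A) : Prop :=
  ∀ n : ℕ, 1 ≤ n → extZero A n M X ∧ extZero A n X M

end ExtDefs

/-! ## The Nakayama functor `ν_A = D ∘ Hom_A(-, A)` -/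

section Nakayama

variable (k A : Type) [Field k] [Ring A] [Algebra k A]

/-- Right multiplication by `a : A` on `Hom_A(X, A)`, as a `k`-linear map. -/
@[simps] def rmulHom (X : Type) [AddCommGroup X] [Module A X] (a : A) :
    (X →ₗ[A] A) →ₗ[k] (X →ₗ[A] A) where
  toFun f :=
    { toFun := fun x => f x * a
      map_add' := fun x y => by simp [add_mul]
      map_smul' := fun c x => by simp [mul_assoc] }
  map_add' f g := by ext x; simp [add_mul]
  map_smul' c f := by ext x; simp [Algebra.smul_def, mul_assoc]

/-- The carrier of the Nakayama functor value `ν_A(X) = D(Hom_A(X,A))`,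
where `D = Hom_k(-,k)`. -/
abbrev NuCarrier (X : Type) [AddCommGroup X] [Module A X] : Type :=
  (X →ₗ[A] A) →ₗ[k] k

/-- The left `A`-module structure on `ν_A(X) = D(Hom_A(X,A))`: `(a • φ) f = φ (f · a)`. -/
instance (X : Type) [AddCommGroup X] [Module A X] : Module A (NuCarrier k A X) where
  smul a φ := φ.comp (rmulHom k A X a)
  one_smul φ := by
    refine LinearMap.ext fun f => ?_
    exact congrArg φ (by ext x; simp)
  mul_smul a b φ := by
    refine LinearMap.ext fun f => ?_
    exact congrArg φ (by ext x; simp [mul_assoc])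
  smul_zero a := rfl
  smul_add a φ ψ := rfl
  add_smul a b φ := by
    refine LinearMap.ext fun f => ?_
    show φ ((rmulHom k A X (a + b)) f) = φ ((rmulHom k A X a) f) + φ ((rmulHom k A X b) f)
    rw [show (rmulHom k A X (a + b)) f = (rmulHom k A X a) f + (rmulHom k A X b) f from by
      ext x; simp [mul_add]]
    exact map_add φ _ _
  zero_smul φ := by
    refine LinearMap.ext fun f => ?_
    show φ ((rmulHom k A X 0) f) = 0
    rw [show (rmulHom k A X 0) f = 0 from by ext x; simp]
    exact map_zero φ

/-- The Nakayama functor value `ν_A(X)` as an object of `ModuleCat A`. -/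
noncomputable def NuMod (X : ModuleCat.{0} A) : ModuleCat.{0} A :=
  ModuleCat.of A (NuCarrier k A ↥X)

/-- `M` is Nakayama-stable: `add M = add (ν_A M)`. -/
noncomputable def NakayamaStable (M : ModuleCat.{0} A) : Prop :=
  ∀ X : ModuleCat.{0} A, MemAdd A M X ↔ MemAdd A (NuMod k A M) X

end Nakayama

/-! ## Filtered colimits -/

section FiltColim

variable (A : Type) [Ring A]

/-- `X` is a filtered colimit of finitely generated modules lying in `𝒢`. -/
noncomputable def FiltColimOfFgG (M X : ModuleCat.{0} A) : Prop :=
  ∃ (J : Cat.{0, 0}) (_ : IsFiltered J) (F : J ⥤ ModuleCat.{0} A)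
    (c : Limits.Cocone F),
    (∀ j, Module.Finite A (F.obj j) ∧ MemG A M (F.obj j)) ∧
      Nonempty (Limits.IsColimit c) ∧ Nonempty (c.pt ≅ X)

end FiltColim



namespace Tach

abbrev EZ {A : Type} [Ring A] (n : ℕ) (X Y : ModuleCat.{0} A) : Prop :=
  Subsingleton (CategoryTheory.Abelian.Ext X Y n)

lemma extZero_iff {A : Type} [Ring A] (n : ℕ) (X Y : ModuleCat.{0} A) :
    extZero A (n+1) X Y ↔ EZ (n+1) X Y := by
  let P := ProjectiveResolution.of X
  have h1 : EZ (n+1) X Y ↔ ∀ f : P.complex.X (n+1) ⟶ Y, P.complex.d (n+2) (n+1) ≫ f = 0 →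
      ∃ g : P.complex.X n ⟶ Y, P.complex.d (n+1) n ≫ g = f := by
    constructor
    · intro h f hf
      exact (P.extMk_eq_zero_iff f (n+2) rfl hf n rfl).1 (Subsingleton.elim _ _)
    · intro h
      refine ⟨fun a b => ?_⟩
      have key : ∀ a : CategoryTheory.Abelian.Ext X Y (n+1), a = 0 := by
        intro a
        obtain ⟨f, hf, rfl⟩ := P.extMk_surjective a (n+2) rfl
        exact (P.extMk_eq_zero_iff f (n+2) rfl hf n rfl).2 (h f hf)
      rw [key a, key b]
  rw [h1, extZero]
  have e := P.isoExt (R := ℤ) (n+1) Y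
  rw [e.toLinearEquiv.toEquiv.subsingleton_congr, ← ModuleCat.isZero_iff_subsingleton,
    ← HomologicalComplex.exactAt_iff_isZero_homology,
    HomologicalComplex.exactAt_iff' _ n (n+1) (n+2) (by simp) (by simp),
    ShortComplex.moduleCat_exact_iff]
  rfl

end Tach

namespace Tach
open CategoryTheory.Abelian
section
variable {A : Type} [Ring A]
variable {X Y Z X₁ X₂ X₃ : Type} [AddCommGroup X] [Module A X] [AddCommGroup Y] [Module A Y]
  [AddCommGroup Z] [Module A Z]
  [AddCommGroup X₁] [Module A X₁] [AddCommGroup X₂] [Module A X₂] [AddCommGroup X₃] [Module A X₃]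

/-- unbundled Ext vanishing -/
abbrev EX (A : Type) [Ring A] (n : ℕ) (X Y : Type) [AddCommGroup X] [Module A X]
    [AddCommGroup Y] [Module A Y] : Prop :=
  EZ n (ModuleCat.of A X) (ModuleCat.of A Y)

/-- short exact sequence of linear maps -/
structure SES (f : X₁ →ₗ[A] X₂) (g : X₂ →ₗ[A] X₃) : Prop where
  inj : Function.Injective f
  surj : Function.Surjective g
  ex : Function.Exact f g

abbrev SES.sc {f : X₁ →ₗ[A] X₂} {g : X₂ →ₗ[A] X₃} (h : SES f g) : ShortComplex (ModuleCat.{0} A) :=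
  ShortComplex.mk (ModuleCat.ofHom f) (ModuleCat.ofHom g) (by
    ext x; exact h.ex.apply_apply_eq_zero x)

lemma SES.se {f : X₁ →ₗ[A] X₂} {g : X₂ →ₗ[A] X₃} (h : SES f g) : h.sc.ShortExact where
  exact := by
    rw [ShortComplex.ShortExact.moduleCat_exact_iff_function_exact]; exact h.ex
  mono_f := (ModuleCat.mono_iff_injective _).2 h.inj
  epi_g := (ModuleCat.epi_iff_surjective _).2 h.surj

lemma EX_of_zero {n : ℕ} (h : ∀ x : Ext (ModuleCat.of A X) (ModuleCat.of A Y) n, x = 0) :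
    EX A n X Y := ⟨fun a b => by rw [h a, h b]⟩

lemma EX_proj [Module.Projective A X] (n : ℕ) : EX A (n+1) X Y := by
  have : Projective (ModuleCat.of A X) := (IsProjective.iff_projective X).1 ‹_›
  exact EX_of_zero fun x => x.eq_zero_of_projective

lemma EX_inj [Module.Injective A Y] (n : ℕ) : EX A (n+1) X Y := by
  have : Injective (ModuleCat.of A Y) := (Module.injective_iff_injective_object A Y).1 ‹_›
  exact EX_of_zero fun x => x.eq_zero_of_injective

/-- E1 -/
lemma SES.shift_left {f : X₁ →ₗ[A] X₂} {g : X₂ →ₗ[A] X₃} (h : SES f g) [Module.Projective A X₂]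
    (n : ℕ) : EX A (n+2) X₃ Y ↔ EX A (n+1) X₁ Y := by
  constructor
  · intro H
    refine EX_of_zero fun x => ?_
    obtain ⟨y, rfl⟩ := Ext.contravariant_sequence_exact₁ h.se (ModuleCat.of A Y) x
      (n₁ := n+2) (by omega) (Subsingleton.elim (h := H) _ _)
    have : EX A (n+1) X₂ Y := EX_proj n
    rw [Subsingleton.elim (h := this) y 0]; simp
  · intro H
    refine EX_of_zero fun x => ?_
    obtain ⟨y, rfl⟩ := Ext.contravariant_sequence_exact₃ h.se (ModuleCat.of A Y) x
      (Subsingleton.elim (h := (EX_proj (n+1) : EX A (n+2) X₂ Y)) _ _) (n₀ := n+1) (by omega)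
    rw [Subsingleton.elim (h := H) y 0]; simp

/-- E2 -/
lemma SES.shift_right {f : X₁ →ₗ[A] X₂} {g : X₂ →ₗ[A] X₃} (h : SES f g) [Module.Injective A X₂]
    (n : ℕ) : EX A (n+2) X X₁ ↔ EX A (n+1) X X₃ := by
  constructor
  · intro H
    refine EX_of_zero fun x => ?_
    obtain ⟨y, rfl⟩ := Ext.covariant_sequence_exact₃ (ModuleCat.of A X) h.se x
      (n₁ := n+2) (by omega) (Subsingleton.elim (h := H) _ _)
    have : EX A (n+1) X X₂ := EX_inj n
    rw [Subsingleton.elim (h := this) y 0]; simp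
  · intro H
    refine EX_of_zero fun x => ?_
    obtain ⟨y, rfl⟩ := Ext.covariant_sequence_exact₁ (ModuleCat.of A X) h.se x
      (Subsingleton.elim (h := (EX_inj (n+1) : EX A (n+2) X X₂)) _ _) (n₀ := n+1) (by omega)
    rw [Subsingleton.elim (h := H) y 0]; simp

/-- E3 -/
lemma SES.lift {f : X₁ →ₗ[A] X₂} {g : X₂ →ₗ[A] X₃} (h : SES f g) (H : EX A 1 X X₁)
    (φ : X →ₗ[A] X₃) : ∃ ψ : X →ₗ[A] X₂, g ∘ₗ ψ = φ := by
  obtain ⟨y, hy⟩ := Ext.covariant_sequence_exact₃ (ModuleCat.of A X) h.se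
    (Ext.mk₀ (ModuleCat.ofHom φ)) (n₁ := 1) (by omega) (Subsingleton.elim (h := H) _ _)
  obtain ⟨z, rfl⟩ := (Ext.mk₀_bijective _ _).2 y
  rw [Ext.mk₀_comp_mk₀] at hy
  have := (Ext.mk₀_bijective _ _).1 hy
  exact ⟨z.hom, congrArg ModuleCat.Hom.hom this⟩

/-- E3 converse -/
lemma SES.EX_one_right {f : X₁ →ₗ[A] X₂} {g : X₂ →ₗ[A] X₃} (h : SES f g) [Module.Injective A X₂]
    (H : ∀ φ : X →ₗ[A] X₃, ∃ ψ : X →ₗ[A] X₂, g ∘ₗ ψ = φ) : EX A 1 X X₁ := by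
  refine EX_of_zero fun x => ?_
  obtain ⟨y, rfl⟩ := Ext.covariant_sequence_exact₁ (ModuleCat.of A X) h.se x
      (Subsingleton.elim (h := (EX_inj 0 : EX A 1 X X₂)) _ _) (n₀ := 0) (by omega)
  obtain ⟨z, rfl⟩ := (Ext.mk₀_bijective _ _).2 y
  obtain ⟨ψ, hψ⟩ := H z.hom
  have : z = ModuleCat.ofHom ψ ≫ h.sc.g := by
    ext x; exact (LinearMap.congr_fun hψ x).symm
  rw [this, ← Ext.mk₀_comp_mk₀, Ext.comp_assoc_of_second_deg_zero, h.se.comp_extClass]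
  simp

/-- E4 -/
lemma SES.EX_one_left {f : X₁ →ₗ[A] X₂} {g : X₂ →ₗ[A] X₃} (h : SES f g) [Module.Projective A X₂]
    (H : ∀ φ : X₁ →ₗ[A] Y, ∃ ψ : X₂ →ₗ[A] Y, ψ ∘ₗ f = φ) : EX A 1 X₃ Y := by
  refine EX_of_zero fun x => ?_
  obtain ⟨y, rfl⟩ := Ext.contravariant_sequence_exact₃ h.se (ModuleCat.of A Y) x
      (Subsingleton.elim (h := (EX_proj 0 : EX A 1 X₂ Y)) _ _) (n₀ := 0) (by omega)
  obtain ⟨z, rfl⟩ := (Ext.mk₀_bijective _ _).2 y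
  obtain ⟨ψ, hψ⟩ := H z.hom
  have : z = h.sc.f ≫ ModuleCat.ofHom ψ := by
    ext x; exact (LinearMap.congr_fun hψ x).symm
  rw [this, ← Ext.mk₀_comp_mk₀, h.se.extClass_comp_assoc]

lemma EX_summand (n : ℕ) {m : ℕ} (a : Fin m → (X →ₗ[A] Z)) (b : Fin m → (Z →ₗ[A] X))
    (hab : ∑ i, (b i) ∘ₗ (a i) = LinearMap.id) (H : EX A n Y Z) : EX A n Y X := by
  refine EX_of_zero fun x => ?_
  have h1 : (∑ i, (ModuleCat.ofHom (a i) ≫ ModuleCat.ofHom (b i))) = 𝟙 (ModuleCat.of A X) := by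
    ext x
    have := LinearMap.congr_fun hab x
    simpa [ModuleCat.hom_sum] using this
  have h2 : x = x.comp (Ext.mk₀ (𝟙 _)) (add_zero _) := by simp
  rw [h2, ← h1]
  have h3 : Ext.mk₀ (∑ i, (ModuleCat.ofHom (a i) ≫ ModuleCat.ofHom (b i)))
     = ∑ i, Ext.mk₀ (ModuleCat.ofHom (a i) ≫ ModuleCat.ofHom (b i)) := by
    exact map_sum (Ext.addEquiv₀ (X := ModuleCat.of A X) (Y := ModuleCat.of A X)).symm _ _
  have h4 : x.comp (Ext.mk₀ (∑ i, (ModuleCat.ofHom (a i) ≫ ModuleCat.ofHom (b i)))) (add_zero _)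
     = ∑ i, x.comp (Ext.mk₀ (ModuleCat.ofHom (a i) ≫ ModuleCat.ofHom (b i))) (add_zero _) := by
    rw [h3]
    exact map_sum (AddMonoidHom.mk' (fun y => x.comp y (add_zero n)) (by simp)) _ _
  rw [h4]
  refine Finset.sum_eq_zero fun i _ => ?_
  rw [← Ext.mk₀_comp_mk₀, ← Ext.comp_assoc_of_third_deg_zero,
    Subsingleton.elim (h := H) (x.comp (Ext.mk₀ (ModuleCat.ofHom (a i))) _) 0]
  simp
end
end Tach

namespace Tach
set_option linter.unusedSectionVars false
open TensorProduct MulOpposite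

section Kasch

lemma ext_of_ker {A : Type} [Ring A] {X Y Q : Type} [AddCommGroup X] [Module A X] [AddCommGroup Y]
    [Module A Y] [AddCommGroup Q] [Module A Q] [hQ : Module.Injective A Q]
    (f : X →ₗ[A] Y) (g : X →ₗ[A] Q) (h : ∀ x, f x = 0 → g x = 0) :
    ∃ u : Y →ₗ[A] Q, ∀ x, u (f x) = g x := by
  let f' : (X ⧸ LinearMap.ker f) →ₗ[A] Y := (LinearMap.ker f).liftQ f le_rfl
  let g' : (X ⧸ LinearMap.ker f) →ₗ[A] Q := (LinearMap.ker f).liftQ g (fun x hx => h x hx)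
  have hf' : Function.Injective f' := by
    rw [← LinearMap.ker_eq_bot]; exact Submodule.ker_liftQ_eq_bot _ _ _ le_rfl
  obtain ⟨u, hu⟩ := Module.Injective.out f' hf' g'
  exact ⟨u, fun x => hu (Submodule.Quotient.mk x)⟩

variable (k A : Type) [Field k] [Ring A] [Algebra k A]

attribute [local instance] TensorProduct.Algebra.module

abbrev BB := A ⊗[k] Aᵐᵒᵖ

variable {k A}

lemma BB_mul_left (N : Submodule (BB k A) A) (a : A) {x : A} (hx : x ∈ N) : a * x ∈ N := by
  have := N.smul_mem (a ⊗ₜ[k] (1 : Aᵐᵒᵖ)) hx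
  rwa [TensorProduct.Algebra.smul_def, one_smul, smul_eq_mul] at this

lemma BB_mul_right (N : Submodule (BB k A) A) (a : A) {x : A} (hx : x ∈ N) : x * a ∈ N := by
  have := N.smul_mem ((1 : A) ⊗ₜ[k] (op a)) hx
  rwa [TensorProduct.Algebra.smul_def, one_smul, op_smul_eq_mul] at this

def mkBB (S : AddSubgroup A) (hl : ∀ a x, x ∈ S → a * x ∈ S) (hr : ∀ a x, x ∈ S → x * a ∈ S) :
    Submodule (BB k A) A where
  carrier := S
  add_mem' := S.add_mem
  zero_mem' := S.zero_mem
  smul_mem' := by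
    intro c x hx
    induction c using TensorProduct.induction_on with
    | zero =>
      have h0 : (0 : BB k A) • x = 0 := by
        rw [← TensorProduct.zero_tmul A (1 : Aᵐᵒᵖ), TensorProduct.Algebra.smul_def, zero_smul]
      exact h0 ▸ S.zero_mem
    | tmul a b =>
      rw [TensorProduct.Algebra.smul_def]
      exact hl _ _ (hr _ _ hx)
    | add a b ha hb => rw [add_smul]; exact S.add_mem ha hb

lemma BB_smul (c : k) (x : A) : c • x = (((algebraMap k A c) ⊗ₜ[k] (1 : Aᵐᵒᵖ)) : BB k A) • x := by
  rw [TensorProduct.Algebra.smul_def, one_smul, smul_eq_mul, Algebra.smul_def]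

instance : IsScalarTower k (BB k A) A where
  smul_assoc c b x := by
    induction b using TensorProduct.induction_on with
    | zero =>
      have h0 : (0 : BB k A) • x = 0 := by
        rw [← TensorProduct.zero_tmul A (1 : Aᵐᵒᵖ), TensorProduct.Algebra.smul_def, zero_smul]
      rw [smul_zero, h0, smul_zero]
    | tmul a b =>
      rw [TensorProduct.smul_tmul', TensorProduct.Algebra.smul_def, TensorProduct.Algebra.smul_def,
        smul_assoc]
    | add a b ha hb => rw [smul_add, add_smul, ha, hb, add_smul, smul_add]

def rAnn (N : Submodule (BB k A) A) : Submodule (BB k A) A :=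
  mkBB { carrier := {a | ∀ x ∈ N, x * a = 0}
         add_mem' := fun ha hb x hx => by rw [mul_add, ha x hx, hb x hx, add_zero]
         zero_mem' := fun x _ => mul_zero x
         neg_mem' := fun ha x hx => by rw [mul_neg, ha x hx, neg_zero] }
    (fun a x hx y hy => by rw [← mul_assoc]; exact hx _ (BB_mul_right N a hy))
    (fun a x hx y hy => by rw [← mul_assoc, hx y hy, zero_mul])

def lAnn (N : Submodule (BB k A) A) : Submodule (BB k A) A :=
  mkBB { carrier := {a | ∀ x ∈ N, a * x = 0}
         add_mem' := fun ha hb x hx => by rw [add_mul, ha x hx, hb x hx, add_zero]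
         zero_mem' := fun x _ => zero_mul x
         neg_mem' := fun ha x hx => by rw [neg_mul, ha x hx, neg_zero] }
    (fun a x hx y hy => by rw [mul_assoc, hx y hy, mul_zero])
    (fun a x hx y hy => by rw [mul_assoc]; exact hx _ (BB_mul_left N a hy))

lemma mem_rAnn {N : Submodule (BB k A) A} {a : A} : a ∈ rAnn N ↔ ∀ x ∈ N, x * a = 0 := Iff.rfl
lemma mem_lAnn {N : Submodule (BB k A) A} {a : A} : a ∈ lAnn N ↔ ∀ x ∈ N, a * x = 0 := Iff.rfl

lemma rAnn_anti {N N' : Submodule (BB k A) A} (h : N ≤ N') : rAnn N' ≤ rAnn N :=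
  fun _ ha x hx => ha x (h hx)

variable [FiniteDimensional k A] [Module.Injective A A]

lemma rAnn_lAnn (N : Submodule (BB k A) A) : rAnn (lAnn N) ≤ N := by
  intro b hb
  let Nk : Submodule k A := N.restrictScalars k
  obtain ⟨n, s, hs⟩ := Submodule.fg_iff_exists_fin_generating_family.1
    (IsNoetherian.noetherian Nk)
  have hsN : ∀ i, s i ∈ N := fun i => by
    have : s i ∈ Nk := by rw [← hs]; exact Submodule.subset_span ⟨i, rfl⟩
    exact this
  let φ : A →ₗ[A] (Fin n → A) := LinearMap.pi fun i => LinearMap.toSpanSingleton A A (s i)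
  obtain ⟨u, hu⟩ := ext_of_ker φ (LinearMap.toSpanSingleton A A b) (by
    intro a ha
    have hl : a ∈ lAnn N := by
      intro x hx
      have hx' : x ∈ Submodule.span k (Set.range s) := by rw [hs]; exact hx
      induction hx' using Submodule.span_induction with
      | mem x h => obtain ⟨i, rfl⟩ := h; exact congrFun ha i
      | zero => simp
      | add x y hx1 hy1 h1 h2 =>
        rw [mul_add, h1 (by change x ∈ Nk; rw [← hs]; exact hx1),
          h2 (by change y ∈ Nk; rw [← hs]; exact hy1), add_zero]
      | smul c x hx1 h1 =>
        rw [mul_smul_comm, h1 (by change x ∈ Nk; rw [← hs]; exact hx1), smul_zero]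
    exact hb a hl)
  have h1 := hu 1
  have h2 : φ 1 = s := by ext i; simp [φ]
  rw [h2, LinearMap.toSpanSingleton_apply, one_smul] at h1
  rw [← h1, LinearMap.pi_apply_eq_sum_univ u s]
  exact N.sum_mem fun i _ => BB_mul_right N _ (hsN i)

lemma rAnn_inf (x y : Submodule (BB k A) A) : rAnn (x ⊓ y) ≤ rAnn x ⊔ rAnn y := by
  intro a ha
  let X : Submodule A A := { x with smul_mem' := fun c z hz => BB_mul_left x c hz }
  let Y : Submodule A A := { y with smul_mem' := fun c z hz => BB_mul_left y c hz }
  obtain ⟨u, hu⟩ := ext_of_ker (LinearMap.coprod X.subtype Y.subtype)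
    (LinearMap.coprod ((LinearMap.toSpanSingleton A A a) ∘ₗ X.subtype) (0 : Y →ₗ[A] A)) (by
      rintro ⟨⟨v, hv⟩, ⟨w, hw⟩⟩ h
      have h' : v + w = 0 := by simpa using h
      have : v = -w := eq_neg_of_add_eq_zero_left h'
      simp only [LinearMap.coprod_apply, LinearMap.coe_comp, Function.comp_apply,
        Submodule.subtype_apply, LinearMap.toSpanSingleton_apply, LinearMap.zero_apply, add_zero]
      exact ha v ⟨hv, by rw [this]; exact y.neg_mem hw⟩)
  have hu1 : ∀ v, u v = v * u 1 := fun v => by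
    conv_lhs => rw [← mul_one v, ← smul_eq_mul, map_smul, smul_eq_mul]
  have e : a = (a - u 1) + u 1 := by abel
  rw [e]
  refine Submodule.add_mem_sup ?_ ?_
  · intro v hv
    have := hu (⟨v, hv⟩, 0)
    simp at this
    rw [hu1] at this
    rw [mul_sub, this, sub_self]
  · intro w hw
    have := hu (0, ⟨w, hw⟩)
    simp at this
    rw [hu1] at this
    exact this

lemma cov_length {R V : Type} [Ring R] [AddCommGroup V] [Module R V] {m n : Submodule R V}
    (h : m ⋖ n) : Module.length R n = Module.length R m + 1 := by
  have h1 := (covBy_iff_quot_is_simple h.le).1 h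
  rw [← Module.length_eq_one_iff] at h1
  rw [← h1]
  refine Module.length_eq_add_of_exact (Submodule.inclusion h.le)
    (Submodule.mkQ (Submodule.comap n.subtype m)) (Submodule.inclusion_injective _)
    (Submodule.mkQ_surjective _) ?_
  rw [LinearMap.exact_iff, Submodule.ker_mkQ, Submodule.range_inclusion]

lemma rAnn_cov {n n' : Submodule (BB k A) A} (h : n ⋖ n') :
    Module.length (BB k A) (rAnn n) ≤ Module.length (BB k A) (rAnn n') + 1 := by
  have hle : rAnn n' ≤ rAnn n := rAnn_anti h.le
  by_cases heq : rAnn n' = rAnn n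
  · rw [heq]; exact le_self_add
  have : rAnn n' ⋖ rAnn n := by
    refine ⟨lt_of_le_of_ne hle heq, ?_⟩
    intro x hx1 hx2
    have hy1 : n ≤ lAnn x ⊓ n' := le_inf (fun a ha z hz => hx2.le hz a ha) h.le
    rcases h.eq_or_eq hy1 inf_le_right with hy | hy
    · have h1 := rAnn_inf (lAnn x) n'
      rw [hy] at h1
      exact absurd (h1.trans (sup_le (rAnn_lAnn x) hx1.le)) hx2.not_ge
    · have h1 : n' ≤ lAnn x := by rw [← hy]; exact inf_le_left
      have : x ≤ rAnn n' := fun z hz a ha => h1 ha z hz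
      exact hx1.not_ge this
  rw [cov_length this]

lemma rAnn_ne_bot (n : Submodule (BB k A) A) (hn : n ≠ ⊤) : rAnn n ≠ ⊥ := by
  have : IsNoetherian (BB k A) A := isNoetherian_of_tower k inferInstance
  have : IsArtinian (BB k A) A := isArtinian_of_tower k inferInstance
  intro h0
  let P : Submodule (BB k A) A → Prop := fun m =>
    Module.length (BB k A) A ≤ Module.length (BB k A) m + Module.length (BB k A) (rAnn m)
  have hbot : P ⊥ := by
    have : rAnn (⊥ : Submodule (BB k A) A) = ⊤ := by
      rw [eq_top_iff]; intro a _ x hx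
      rw [(Submodule.mem_bot _).1 hx, zero_mul]
    have h2 := congrArg (fun N : Submodule (BB k A) A => Module.length (BB k A) N) this
    simp only [P]
    rw [h2]
    simp
  obtain ⟨m, ⟨hmn, hm⟩, hmax⟩ := set_has_maximal_iff_noetherian.2 ‹IsNoetherian (BB k A) A›
    {m | m ≤ n ∧ P m} ⟨⊥, bot_le, hbot⟩
  have hPn : P n := by
    rcases eq_or_lt_of_le hmn with h | h
    · rwa [← h]
    obtain ⟨m', hm', hm'n⟩ := exists_covBy_le_of_lt h
    exfalso
    refine hmax m' ⟨hm'n, ?_⟩ hm'.lt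
    refine hm.trans ?_
    rw [cov_length hm', add_assoc, add_comm 1]
    gcongr
    exact rAnn_cov hm'
  have h1 := Submodule.length_lt hn
  have h2 := congrArg (fun N : Submodule (BB k A) A => Module.length (BB k A) N) h0
  simp only [P] at hPn
  rw [h2] at hPn
  simp only [Module.length_bot, add_zero] at hPn
  exact absurd h1 hPn.not_gt

lemma exists_functional_simple (k : Type) {A : Type} [Field k] [Ring A] [Algebra k A]
    [FiniteDimensional k A] [Module.Injective A A] (m : Submodule A A) (hm : m ≠ ⊤) :
    ∃ f : (A ⧸ m) →ₗ[A] A, f ≠ 0 := by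
  let n : Submodule (BB k A) A := mkBB
    { carrier := {a | ∀ b, a * b ∈ m}
      add_mem' := fun ha hb c => by rw [add_mul]; exact m.add_mem (ha c) (hb c)
      zero_mem' := fun c => by rw [zero_mul]; exact m.zero_mem
      neg_mem' := fun ha c => by rw [neg_mul]; exact m.neg_mem (ha c) }
    (fun a x hx b => by rw [mul_assoc]; exact m.smul_mem a (hx b))
    (fun a x hx b => by rw [mul_assoc]; exact hx _)
  have hn : n ≠ ⊤ := by
    intro h
    apply hm
    rw [eq_top_iff]
    intro a _
    have : a ∈ n := by rw [h]; trivial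
    simpa using this 1
  obtain ⟨a, ha, ha0⟩ := Submodule.exists_mem_ne_zero_of_ne_bot (rAnn_ne_bot n hn)
  obtain ⟨d, s, hs⟩ := Submodule.fg_iff_exists_fin_generating_family.1
    (IsNoetherian.noetherian (⊤ : Submodule k A))
  let φ : A →ₗ[A] (Fin d → A ⧸ m) := LinearMap.pi fun i =>
    m.mkQ ∘ₗ LinearMap.toSpanSingleton A A (s i)
  obtain ⟨u, hu⟩ := ext_of_ker φ (LinearMap.toSpanSingleton A A a) (by
    intro x hx
    refine ha x ?_
    intro b
    have hb : b ∈ Submodule.span k (Set.range s) := by rw [hs]; trivial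
    induction hb using Submodule.span_induction with
    | mem y h => 
      obtain ⟨i, rfl⟩ := h
      exact (Submodule.Quotient.mk_eq_zero m).1 (congrFun hx i)
    | zero => simp
    | add y z _ _ h1 h2 => rw [mul_add]; exact m.add_mem h1 h2
    | smul c y _ h1 =>
      rw [mul_smul_comm, ← algebraMap_smul A c (x * y)]; exact m.smul_mem _ h1)
  by_contra! H
  have h1 := hu 1
  rw [LinearMap.toSpanSingleton_apply, one_smul] at h1
  apply ha0
  rw [← h1, ← Finset.univ_sum_single (φ 1), map_sum]
  refine Finset.sum_eq_zero fun i _ => ?_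
  have := H (u ∘ₗ LinearMap.single A (fun _ => A ⧸ m) i)
  exact LinearMap.congr_fun this _

lemma exists_functional (k : Type) {A : Type} [Field k] [Ring A] [Algebra k A]
    [FiniteDimensional k A] [Module.Injective A A] {X : Type} [AddCommGroup X] [Module A X] (x : X) (hx : x ≠ 0) :
    ∃ f : X →ₗ[A] A, f x ≠ 0 := by
  let φ := LinearMap.toSpanSingleton A X x
  have hk : LinearMap.ker φ ≠ ⊤ := by
    intro h
    have : (1 : A) ∈ LinearMap.ker φ := by rw [h]; trivial
    apply hx
    simpa [φ] using this
  obtain ⟨f, hf⟩ := exists_functional_simple k _ hk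
  obtain ⟨u, hu⟩ := ext_of_ker φ (f ∘ₗ (LinearMap.ker φ).mkQ) (by
    intro a ha
    have : (LinearMap.ker φ).mkQ a = 0 := (Submodule.Quotient.mk_eq_zero _).2 ha
    rw [LinearMap.comp_apply, this, map_zero])
  refine ⟨u, fun h => hf ?_⟩
  have h1 := hu 1
  have h2 : φ 1 = x := by simp [φ]
  rw [h2, h] at h1
  ext
  simpa using h1.symm

lemma exists_embedding (k : Type) {A : Type} [Field k] [Ring A] [Algebra k A]
    [FiniteDimensional k A] [Module.Injective A A] (X : Type) [AddCommGroup X] [Module A X]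
    [Module.Finite A X] : ∃ (d : ℕ) (f : X →ₗ[A] (Fin d → A)), Function.Injective f := by
  have : IsArtinian A A := isArtinian_of_tower k inferInstance
  have : IsArtinianRing A := this
  obtain ⟨m, ⟨d, f, rfl⟩, hmin⟩ := IsArtinian.set_has_minimal (R := A) (M := X)
    {m | ∃ (d : ℕ) (f : X →ₗ[A] (Fin d → A)), LinearMap.ker f = m} ⟨_, 0, 0, rfl⟩
  refine ⟨d, f, LinearMap.ker_eq_bot.1 ?_⟩
  by_contra h
  obtain ⟨x, hx, hx0⟩ := Submodule.exists_mem_ne_zero_of_ne_bot h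
  obtain ⟨g, hg⟩ : ∃ g : X →ₗ[A] A, g x ≠ 0 := exists_functional k x hx0
  let f' : X →ₗ[A] (Fin (d+1) → A) := LinearMap.pi (Fin.cons g fun i => LinearMap.proj i ∘ₗ f)
  have hf' : ∀ y, f' y = 0 → g y = 0 ∧ f y = 0 := by
    intro y hy
    refine ⟨congrFun hy 0, ?_⟩
    ext i
    exact congrFun hy i.succ
  refine hmin (LinearMap.ker f') ⟨_, _, rfl⟩ ?_
  refine SetLike.lt_iff_le_and_exists.2 ⟨fun y hy => (hf' y hy).2, x, hx, fun h => hg (hf' x h).1⟩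

end Kasch
end Tach

namespace Tach

section FFsec
variable {A : Type} [Ring A]
variable {X Y Z W : Type} [AddCommGroup X] [Module A X] [AddCommGroup Y] [Module A Y]
  [AddCommGroup Z] [Module A Z] [AddCommGroup W] [Module A W]

/-- the map factors through a finite free module -/
def FF (φ : X →ₗ[A] Y) : Prop :=
  ∃ (ι : Type) (_ : Fintype ι) (a : X →ₗ[A] (ι → A)) (b : (ι → A) →ₗ[A] Y), φ = b ∘ₗ a

/-- all maps factor through finite free modules -/
def SZ (A : Type) [Ring A] (X Y : Type) [AddCommGroup X] [Module A X] [AddCommGroup Y]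
    [Module A Y] : Prop := ∀ φ : X →ₗ[A] Y, FF φ

lemma FF.comp_left {φ : X →ₗ[A] Y} (h : FF φ) (ψ : Y →ₗ[A] Z) : FF (ψ ∘ₗ φ) := by
  obtain ⟨ι, _, a, b, rfl⟩ := h
  exact ⟨ι, inferInstance, a, ψ ∘ₗ b, rfl⟩

lemma FF.comp_right {φ : X →ₗ[A] Y} (h : FF φ) (ψ : Z →ₗ[A] X) : FF (φ ∘ₗ ψ) := by
  obtain ⟨ι, _, a, b, rfl⟩ := h
  exact ⟨ι, inferInstance, a ∘ₗ ψ, b, rfl⟩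

lemma FF_of {ι : Type} [Fintype ι] (a : X →ₗ[A] (ι → A)) (b : (ι → A) →ₗ[A] Y) : FF (b ∘ₗ a) :=
  ⟨ι, inferInstance, a, b, rfl⟩

lemma FF_zero : FF (0 : X →ₗ[A] Y) := ⟨Fin 0, inferInstance, 0, 0, rfl⟩

lemma FF.add {φ ψ : X →ₗ[A] Y} (h : FF φ) (h' : FF ψ) : FF (φ + ψ) := by
  obtain ⟨ι, _, a, b, rfl⟩ := h
  obtain ⟨κ, _, c, d, rfl⟩ := h'
  let e := LinearEquiv.sumArrowLequivProdArrow ι κ A A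
  refine ⟨ι ⊕ κ, inferInstance, e.symm.toLinearMap ∘ₗ a.prod c, (b.coprod d) ∘ₗ e.toLinearMap, ?_⟩
  ext x
  simp

lemma FF_sum {ι : Type} (s : Finset ι) (f : ι → (X →ₗ[A] Y)) (h : ∀ i ∈ s, FF (f i)) :
    FF (∑ i ∈ s, f i) := by
  classical
  induction s using Finset.induction_on with
  | empty => simpa using FF_zero
  | insert i s hi ih =>
    rw [Finset.sum_insert hi]
    exact (h i (by simp)).add (ih fun j hj => h j (by simp [hj]))

/-- maps from f.g. to finsupp have finite support -/
lemma finsupp_fg [Module.Finite A X] {I : Type} (φ : X →ₗ[A] (I →₀ Y)) :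
    ∃ s : Finset I, φ = ∑ i ∈ s, Finsupp.lsingle i ∘ₗ (Finsupp.lapply i ∘ₗ φ) := by
  classical
  obtain ⟨n, x, hx⟩ := Module.Finite.exists_fin (R := A) (M := X)
  refine ⟨Finset.univ.biUnion fun i => (φ (x i)).support, ?_⟩
  refine LinearMap.ext_on_range hx fun j => ?_
  rw [LinearMap.sum_apply]
  conv_lhs => rw [← Finsupp.sum_single (φ (x j))]
  refine Finset.sum_subset ?_ ?_
  · exact Finset.subset_biUnion_of_mem (fun i => (φ (x i)).support) (Finset.mem_univ j)
  · intro i _ hi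
    rw [Finsupp.notMem_support_iff.1 hi]; simp

lemma SZ_finsupp [Module.Finite A X] {I : Type} (h : SZ A X Y) : SZ A X (I →₀ Y) := by
  intro φ
  obtain ⟨s, hs⟩ := finsupp_fg φ
  rw [hs]
  exact FF_sum _ _ fun i _ => (h _).comp_left _

instance injPi {ι : Type} [hA : Module.Injective A A] : Module.Injective A (ι → A) where
  out := by
    intro X Y _ _ _ _ f hf g
    choose u hu using fun i => Module.Injective.out f hf (LinearMap.proj i ∘ₗ g)
    exact ⟨LinearMap.pi u, fun x => funext fun i => hu i x⟩

variable {X₁ X₂ X₃ : Type} [AddCommGroup X₁] [Module A X₁] [AddCommGroup X₂] [Module A X₂]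
  [AddCommGroup X₃] [Module A X₃]

lemma SES.desc {f : X₁ →ₗ[A] X₂} {g : X₂ →ₗ[A] X₃} (h : SES f g) (φ : X₂ →ₗ[A] Z)
    (hφ : φ ∘ₗ f = 0) : ∃ ψ : X₃ →ₗ[A] Z, ψ ∘ₗ g = φ := by
  have hk : LinearMap.ker g ≤ LinearMap.ker φ := by
    intro x hx
    obtain ⟨y, rfl⟩ := (h.ex x).1 hx
    exact LinearMap.congr_fun hφ y
  refine ⟨((LinearMap.ker g).liftQ φ hk) ∘ₗ (g.quotKerEquivOfSurjective h.surj).symm.toLinearMap, ?_⟩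
  ext x
  have : (g.quotKerEquivOfSurjective h.surj).symm (g x) = Submodule.Quotient.mk x := by
    rw [LinearEquiv.symm_apply_eq]; rfl
  simp [this]

lemma SES.liftKer {f : X₁ →ₗ[A] X₂} {g : X₂ →ₗ[A] X₃} (h : SES f g) (φ : Z →ₗ[A] X₂)
    (hφ : g ∘ₗ φ = 0) : ∃ ψ : Z →ₗ[A] X₁, f ∘ₗ ψ = φ := by
  let e := LinearEquiv.ofInjective f h.inj
  refine ⟨e.symm.toLinearMap ∘ₗ (φ.codRestrict (LinearMap.range f) fun x =>
    (h.ex _).1 (LinearMap.congr_fun hφ x)), ?_⟩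
  ext x
  have : f (e.symm ⟨φ x, (h.ex _).1 (LinearMap.congr_fun hφ x)⟩) = φ x := by
    have := e.apply_symm_apply ⟨φ x, (h.ex _).1 (LinearMap.congr_fun hφ x)⟩
    exact congrArg Subtype.val this
  exact this

lemma inj_extend {Q : Type} [AddCommGroup Q] [Module A Q] [Module.Injective A Q]
    (f : X →ₗ[A] Y) (hf : Function.Injective f) (g : X →ₗ[A] Q) :
    ∃ h : Y →ₗ[A] Q, h ∘ₗ f = g := by
  obtain ⟨u, hu⟩ := Module.Injective.out f hf g
  exact ⟨u, LinearMap.ext hu⟩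

lemma FF.extend [Module.Injective A A] {φ : X →ₗ[A] Z} (h : FF φ) (f : X →ₗ[A] Y)
    (hf : Function.Injective f) : ∃ ψ : Y →ₗ[A] Z, FF ψ ∧ ψ ∘ₗ f = φ := by
  obtain ⟨ι, _, a, b, rfl⟩ := h
  obtain ⟨u, rfl⟩ := inj_extend f hf a
  exact ⟨b ∘ₗ u, FF_of _ _, rfl⟩

lemma FF.lift {φ : X →ₗ[A] Z} (h : FF φ) (g : Y →ₗ[A] Z)
    (hg : Function.Surjective g) : ∃ ψ : X →ₗ[A] Y, FF ψ ∧ g ∘ₗ ψ = φ := by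
  obtain ⟨ι, _, a, b, rfl⟩ := h
  obtain ⟨u, rfl⟩ := Module.projective_lifting_property g b hg
  exact ⟨u ∘ₗ a, FF_of _ _, rfl⟩

/-- L1 -/
lemma SES.L1 {ι : Z →ₗ[A] W} {q : W →ₗ[A] Y} (h : SES ι q) (hX : SZ A X Y) (φ : X →ₗ[A] W) :
    ∃ ψ : X →ₗ[A] Z, ∃ ρ : X →ₗ[A] W, FF ρ ∧ φ = ι ∘ₗ ψ + ρ := by
  obtain ⟨ρ, hρ, e⟩ := (hX (q ∘ₗ φ)).lift q h.surj
  obtain ⟨ψ, hψ⟩ := h.liftKer (φ - ρ) (by rw [LinearMap.comp_sub, e, sub_self])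
  exact ⟨ψ, ρ, hρ, by rw [hψ]; abel⟩

lemma SES.SZ_mid {ι : Z →ₗ[A] W} {q : W →ₗ[A] Y} (h : SES ι q) (hX : SZ A X Y) (hZ : SZ A X Z) :
    SZ A X W := by
  intro φ
  obtain ⟨ψ, ρ, hρ, rfl⟩ := h.L1 hX φ
  exact ((hZ ψ).comp_left ι).add hρ

/-- L3 -/
lemma L3 [Module.Injective A A] {n : ℕ} {i : X₁ →ₗ[A] (Fin n → A)} {p : (Fin n → A) →ₗ[A] X₂}
    (hs : SES i p) {ι : Z →ₗ[A] W} {q : W →ₗ[A] Y} (h : SES ι q) (h2 : SZ A X₂ Y)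
    (ψ : X₁ →ₗ[A] Z) (hψ : FF (ι ∘ₗ ψ)) : FF ψ := by
  obtain ⟨g, -, hg⟩ := hψ.extend i hs.inj
  obtain ⟨s, hs'⟩ := hs.desc (q ∘ₗ g) (by
    rw [LinearMap.comp_assoc, hg, ← LinearMap.comp_assoc, h.ex.linearMap_comp_eq_zero,
      LinearMap.zero_comp])
  obtain ⟨r, -, hr⟩ := (h2 s).lift q h.surj
  obtain ⟨t, ht⟩ := h.liftKer (g - r ∘ₗ p) (by
    rw [LinearMap.comp_sub, ← LinearMap.comp_assoc, hr, hs', sub_self])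
  have : ψ = t ∘ₗ i := by
    ext x
    apply h.inj
    have h1 := LinearMap.congr_fun ht (i x)
    have h2 := LinearMap.congr_fun hg x
    have h3 := hs.ex.apply_apply_eq_zero x
    simp only [LinearMap.comp_apply, LinearMap.sub_apply] at h1 h2 ⊢
    rw [h1, h2, h3, map_zero, sub_zero]
  rw [this]
  exact FF_of _ _

/-- (ii) -/
lemma SZ_step [Module.Injective A A] {m n : ℕ} {i : X₁ →ₗ[A] (Fin n → A)}
    {p : (Fin n → A) →ₗ[A] X₂}
    (hs : SES i p) {j : Z →ₗ[A] (Fin m → A)} {q : (Fin m → A) →ₗ[A] W} (h : SES j q)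
    (H : SZ A X₁ Z) : SZ A X₂ W := by
  intro s
  obtain ⟨g, hg⟩ := Module.projective_lifting_property q (s ∘ₗ p) h.surj
  obtain ⟨t, ht⟩ := h.liftKer (g ∘ₗ i) (by
    rw [← LinearMap.comp_assoc, hg, LinearMap.comp_assoc, hs.ex.linearMap_comp_eq_zero,
      LinearMap.comp_zero])
  obtain ⟨t', -, ht'⟩ := (H t).extend i hs.inj
  obtain ⟨w, hw⟩ := hs.desc (g - j ∘ₗ t') (by
    rw [LinearMap.sub_comp, LinearMap.comp_assoc, ht', ht, sub_self])
  have : s = q ∘ₗ w := by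
    ext x
    obtain ⟨y, rfl⟩ := hs.surj x
    have h1 := LinearMap.congr_fun hw y
    have h2 := LinearMap.congr_fun hg y
    simp only [LinearMap.comp_apply, LinearMap.sub_apply] at h1 h2 ⊢
    rw [h1, map_sub, h2, h.ex.apply_apply_eq_zero, sub_zero]
  rw [this]
  exact FF_of w q

end FFsec
end Tach

namespace Tach

section Cores

/-- a coresolution by finite free modules -/
structure CoRes (A : Type) [Ring A] where
  C : ℕ → ModuleCat.{0} A
  fin : ∀ j, Module.Finite A (C j)
  d : ℕ → ℕ
  i : ∀ j, C j →ₗ[A] (Fin (d j) → A)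
  p : ∀ j, (Fin (d j) → A) →ₗ[A] C (j+1)
  ses : ∀ j, SES (i j) (p j)

attribute [instance] CoRes.fin

lemma exists_cores (k : Type) {A : Type} [Field k] [Ring A] [Algebra k A]
    [FiniteDimensional k A] [Module.Injective A A] (M : ModuleCat.{0} A) [hM : Module.Finite A M] :
    ∃ R : CoRes A, R.C 0 = M := by
  have step : ∀ X : {X : ModuleCat.{0} A // Module.Finite A X},
      ∃ (Y : {X : ModuleCat.{0} A // Module.Finite A X}) (d : ℕ) (i : X.1 →ₗ[A] (Fin d → A))
        (p : (Fin d → A) →ₗ[A] Y.1), SES i p := by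
    rintro ⟨X, hX⟩
    obtain ⟨d, f, hf⟩ := exists_embedding k (A := A) X
    refine ⟨⟨ModuleCat.of A ((Fin d → A) ⧸ LinearMap.range f), ?_⟩, d, f,
      (LinearMap.range f).mkQ, hf, Submodule.mkQ_surjective _, LinearMap.exact_map_mkQ_range f⟩
    change Module.Finite A ((Fin d → A) ⧸ LinearMap.range f)
    infer_instance
  choose Y d i p h using step
  let C : ℕ → {X : ModuleCat.{0} A // Module.Finite A X} := fun n =>
    Nat.rec ⟨M, hM⟩ (fun _ X => Y X) n
  exact ⟨⟨fun n => (C n).1, fun n => (C n).2, fun n => d (C n), fun n => i (C n), fun n => p (C n),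
    fun n => h (C n)⟩, rfl⟩

variable {A : Type} [Ring A] (R : CoRes A)
variable {X : Type} [AddCommGroup X] [Module A X]

lemma CoRes.EX_C [Module.Injective A A] (h : ∀ n, EX A (n+1) X (R.C 0)) (j n : ℕ) :
    EX A (n+1) X (R.C j) := by
  induction j generalizing n with
  | zero => exact h n
  | succ j ih => exact ((R.ses j).shift_right n).1 (ih (n+1))

/-- (i) -/
lemma CoRes.SZ_C [Module.Injective A A] (h : ∀ n, EX A (n+1) X (R.C 0)) (j : ℕ) :
    SZ A X (R.C (j+1)) := by
  intro φ
  obtain ⟨ψ, rfl⟩ := (R.ses j).lift (R.EX_C h j 0) φ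
  exact FF_of _ _

lemma CoRes.SZ_CC [Module.Injective A A] (h : ∀ n, EX A (n+1) (R.C 0) (R.C 0)) (j m : ℕ) :
    SZ A (R.C j) (R.C (j+m+1)) := by
  induction j with
  | zero =>
    have := R.SZ_C h m
    rwa [show 0 + m + 1 = m + 1 by omega]
  | succ j ih =>
    have := SZ_step (R.ses j) (R.ses (j+m+1)) ih
    rwa [show j + 1 + m + 1 = j + m + 1 + 1 by omega]

lemma CoRes.SZ_lt [Module.Injective A A] (h : ∀ n, EX A (n+1) (R.C 0) (R.C 0)) {j m : ℕ}
    (hjm : j < m) : SZ A (R.C j) (R.C m) := by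
  obtain ⟨r, rfl⟩ := Nat.exists_eq_add_of_lt hjm
  exact R.SZ_CC h j r

/-- syzygy dimension shifting -/
lemma EX_of_SZ [IsNoetherianRing A] [Module.Injective A A] {M Y : Type} [AddCommGroup M]
    [Module A M] [AddCommGroup Y] [Module A Y]
    (hY : ∀ (X : Type) [AddCommGroup X] [Module A X] [Module.Finite A X],
      (∀ n, EX A (n+1) X M) → SZ A X Y) (n : ℕ) :
    ∀ (X : Type) [AddCommGroup X] [Module A X] [Module.Finite A X],
      (∀ n, EX A (n+1) X M) → EX A (n+1) X Y := by
  induction n with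
  | zero =>
    intro X _ _ _ hX
    obtain ⟨d, f, hf⟩ := Module.Finite.exists_fin' A X
    have hs : SES (LinearMap.ker f).subtype f :=
      ⟨Submodule.subtype_injective _, hf, LinearMap.exact_subtype_ker_map f⟩
    refine hs.EX_one_left fun φ => ?_
    obtain ⟨ψ, -, h⟩ := (hY (LinearMap.ker f) (fun n => (hs.shift_left n).1 (hX _)) φ).extend _ hs.inj
    exact ⟨ψ, h⟩
  | succ n ih =>
    intro X _ _ _ hX
    obtain ⟨d, f, hf⟩ := Module.Finite.exists_fin' A X
    have hs : SES (LinearMap.ker f).subtype f :=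
      ⟨Submodule.subtype_injective _, hf, LinearMap.exact_subtype_ker_map f⟩
    exact (hs.shift_left n).2 (ih _ fun n => (hs.shift_left n).1 (hX _))

end Cores

section Cell
variable {A : Type} [Ring A]

/-- cell attachment -/
lemma exists_cell {C F C' : Type} [AddCommGroup C] [Module A C] [AddCommGroup F] [Module A F]
    [AddCommGroup C'] [Module A C'] {i : C →ₗ[A] F} {p : F →ₗ[A] C'} (h : SES i p)
    (Z : ModuleCat.{0} A) :
    ∃ (Z' : ModuleCat.{0} A) (I : Type) (ι : Z →ₗ[A] Z') (q : Z' →ₗ[A] (I →₀ C')), SES ι q ∧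
      ∀ f : C →ₗ[A] Z, ∃ g : F →ₗ[A] Z', g ∘ₗ i = ι ∘ₗ f := by
  classical
  let I := C →ₗ[A] Z
  let ev : (I →₀ C) →ₗ[A] Z := Finsupp.lsum ℕ fun f => f
  let J : (I →₀ C) →ₗ[A] (I →₀ F) := Finsupp.mapRange.linearMap i
  let P : (I →₀ F) →ₗ[A] (I →₀ C') := Finsupp.mapRange.linearMap p
  have hJ : Function.Injective J := Finsupp.mapRange_injective _ (map_zero i) h.inj
  have hP : Function.Surjective P := Finsupp.mapRange_surjective _ (map_zero p) h.surj
  have hJP : ∀ y, P y = 0 → ∃ x, J x = y := by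
    intro y hy
    choose! s hs using fun z => (h.ex z).1
    have hs0 : s 0 = 0 := h.inj (by rw [hs 0 (map_zero p), map_zero])
    refine ⟨Finsupp.mapRange s hs0 y, ?_⟩
    ext a
    have : p (y a) = 0 := by
      have := DFunLike.congr_fun hy a
      simpa [P] using this
    simp [J, hs _ this]
  let r : (I →₀ C) →ₗ[A] (Z × (I →₀ F)) := (-ev).prod J
  let N := LinearMap.range r
  let Z' := (Z × (I →₀ F)) ⧸ N
  let ι : Z →ₗ[A] Z' := N.mkQ ∘ₗ LinearMap.inl A Z (I →₀ F)
  let q : Z' →ₗ[A] (I →₀ C') := N.liftQ (P ∘ₗ LinearMap.snd A Z (I →₀ F)) (by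
    rintro _ ⟨x, rfl⟩
    ext a
    simp [r, J, P, h.ex.apply_apply_eq_zero])
  refine ⟨ModuleCat.of A Z', I, ι, q, ⟨?_, ?_, ?_⟩, ?_⟩
  · rw [← LinearMap.ker_eq_bot, LinearMap.ker_eq_bot']
    intro z hz
    obtain ⟨x, hx⟩ := (Submodule.Quotient.mk_eq_zero N).1 hz
    have h1 : J x = 0 := congrArg Prod.snd hx
    have h2 : x = 0 := hJ (by rw [h1, map_zero])
    have h3 : r x = (z, 0) := hx
    rw [h2, map_zero] at h3
    exact (congrArg Prod.fst h3).symm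
  · intro y
    obtain ⟨x, rfl⟩ := hP y
    exact ⟨N.mkQ (0, x), rfl⟩
  · intro y
    obtain ⟨⟨z, x⟩, rfl⟩ := Submodule.mkQ_surjective N y
    constructor
    · intro hy
      obtain ⟨w, rfl⟩ := hJP x hy
      refine ⟨z + ev w, ?_⟩
      refine (Submodule.Quotient.eq N).2 ⟨-w, ?_⟩
      simp [r]
    · rintro ⟨w, hw⟩
      rw [← hw]
      change P 0 = 0
      simp
  · intro f
    refine ⟨N.mkQ ∘ₗ LinearMap.inr A Z (I →₀ F) ∘ₗ Finsupp.lsingle f, ?_⟩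
    ext c
    refine (Submodule.Quotient.eq N).2 ⟨Finsupp.single f c, ?_⟩
    simp [r, ev, J]

end Cell
end Tach

namespace Tach

section Tower
variable {A : Type} [Ring A]

lemma exists_limit (Z : ℕ → ModuleCat.{0} A) (ι : ∀ i, Z i →ₗ[A] Z (i+1))
    (hι : ∀ i, Function.Injective (ι i)) :
    ∃ (Y : ModuleCat.{0} A) (α : ∀ i, Z i →ₗ[A] Y), (∀ i, Function.Injective (α i)) ∧
      (∀ i, α (i+1) ∘ₗ ι i = α i) ∧ ∀ y, ∃ i x, α i x = y := by
  let F : ℕ ⥤ ModuleCat.{0} A := Functor.ofSequence (fun i => ModuleCat.ofHom (ι i))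
  have hinj : ∀ (j i : ℕ) (h : i ≤ j), Function.Injective (F.map (homOfLE h)) := by
    intro j
    induction j with
    | zero =>
      intro i h
      obtain rfl : i = 0 := by omega
      have : homOfLE h = 𝟙 _ := rfl
      rw [this, F.map_id]; exact fun a b h => h
    | succ j ih =>
      intro i h
      rcases Nat.lt_or_ge j i with h' | h'
      · obtain rfl : i = j+1 := by omega
        have : homOfLE h = 𝟙 _ := rfl
        rw [this, F.map_id]; exact fun a b h => h
      · have : homOfLE h = homOfLE h' ≫ homOfLE (Nat.le_succ j) := rfl
        rw [this, F.map_comp, Functor.ofSequence_map_homOfLE_succ]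
        exact (hι j).comp (ih i h')
  refine ⟨Limits.colimit F, fun i => (Limits.colimit.ι F i).hom, ?_, ?_, ?_⟩
  · intro i x y hxy
    obtain ⟨j, f, g, hfg⟩ := Limits.Concrete.colimit_exists_of_rep_eq (F := F) x y hxy
    have : f = g := Subsingleton.elim _ _
    subst this
    exact hinj j i (leOfHom f) hfg
  · intro i
    have := Limits.colimit.w F (homOfLE (Nat.le_succ i))
    rw [Functor.ofSequence_map_homOfLE_succ] at this
    exact congrArg ModuleCat.Hom.hom this
  · intro y
    exact Limits.Concrete.colimit_exists_rep F y

lemma fg_factor {X : Type} [AddCommGroup X] [Module A X] [Module.Finite A X]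
    {Z : ℕ → ModuleCat.{0} A} {ι : ∀ i, Z i →ₗ[A] Z (i+1)} {Y : ModuleCat.{0} A}
    {α : ∀ i, Z i →ₗ[A] Y} (hα : ∀ i, Function.Injective (α i))
    (hc : ∀ i, α (i+1) ∘ₗ ι i = α i) (hs : ∀ y, ∃ i x, α i x = y) (φ : X →ₗ[A] Y) (n : ℕ) :
    ∃ i, n ≤ i ∧ ∃ ψ : X →ₗ[A] Z i, φ = α i ∘ₗ ψ := by
  have hmono : Monotone fun i => LinearMap.range (α i) := by
    refine monotone_nat_of_le_succ fun i => ?_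
    rintro _ ⟨x, rfl⟩
    exact ⟨ι i x, LinearMap.congr_fun (hc i) x⟩
  obtain ⟨m, x, hx⟩ := Module.Finite.exists_fin (R := A) (M := X)
  choose s y hy using fun j => hs (φ (x j))
  let N := max n (Finset.univ.sup s)
  have hr : LinearMap.range φ ≤ LinearMap.range (α N) := by
    rw [LinearMap.range_eq_map, ← hx, Submodule.map_span, Submodule.span_le]
    rintro _ ⟨_, ⟨j, rfl⟩, rfl⟩
    refine hmono (le_trans (Finset.le_sup (Finset.mem_univ j)) (le_max_right n _)) ?_
    exact ⟨y j, hy j⟩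
  let e := LinearEquiv.ofInjective (α N) (hα N)
  refine ⟨N, le_max_left _ _, e.symm.toLinearMap ∘ₗ (φ.codRestrict (LinearMap.range (α N))
    fun z => hr ⟨z, rfl⟩), ?_⟩
  ext z
  have := e.apply_symm_apply ⟨φ z, hr ⟨z, rfl⟩⟩
  exact (congrArg Subtype.val this).symm

/-- the tower -/
structure Tow (R : CoRes A) where
  Z : ℕ → ModuleCat.{0} A
  I : ℕ → Type
  ι : ∀ i, Z i →ₗ[A] Z (i+1)
  q : ∀ i, Z (i+1) →ₗ[A] (I i →₀ R.C (i+3))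
  ses : ∀ i, SES (ι i) (q i)
  kill : ∀ i (f : R.C (i+2) →ₗ[A] Z i), ∃ g : (Fin (R.d (i+2)) → A) →ₗ[A] Z (i+1),
    g ∘ₗ R.i (i+2) = ι i ∘ₗ f
  Y : ModuleCat.{0} A
  α : ∀ i, Z i →ₗ[A] Y
  inj : ∀ i, Function.Injective (α i)
  comm : ∀ i, α (i+1) ∘ₗ ι i = α i
  surj : ∀ y, ∃ i x, α i x = y
  β : R.C 1 →ₗ[A] Z 0
  β' : Z 0 →ₗ[A] R.C 1
  ββ' : β' ∘ₗ β = LinearMap.id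
  β'β : β ∘ₗ β' = LinearMap.id

def towZ (C : ModuleCat.{0} A) (S : ℕ → ModuleCat.{0} A → ModuleCat.{0} A) : ℕ → ModuleCat.{0} A
  | 0 => C
  | (n+1) => S (n+2) (towZ C S n)

lemma exists_tow (R : CoRes A) : Nonempty (Tow R) := by
  choose Z' I ι q h hk using fun (m : ℕ) (Z : ModuleCat.{0} A) => exists_cell (R.ses m) Z
  let Z : ℕ → ModuleCat.{0} A := towZ (R.C 1) Z'
  let ι' : ∀ i : ℕ, (Z i : Type) →ₗ[A] (Z (i+1) : Type) := fun i => ι (i+2) (Z i)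
  have hι' : ∀ i, Function.Injective (ι' i) := fun i => (h (i+2) (Z i)).inj
  obtain ⟨Y, α, h1, h2, h3⟩ := exists_limit Z ι' hι'
  exact ⟨{ Z := Z, I := fun i => I (i+2) (Z i), ι := ι',
           q := fun i => q (i+2) (Z i), ses := fun i => h (i+2) (Z i),
           kill := fun i => hk (i+2) (Z i)
           Y := Y, α := α, inj := h1, comm := h2, surj := h3,
           β := LinearMap.id, β' := LinearMap.id, ββ' := rfl, β'β := rfl }⟩

variable {R : CoRes A} (T : Tow R) {X : Type} [AddCommGroup X] [Module A X] [Module.Finite A X]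

/-- L2 -/
lemma Tow.SZ_of (h : ∀ j, SZ A X (R.C (j+1))) (i : ℕ) : SZ A X (T.Z i) := by
  induction i with
  | zero =>
    intro φ
    have := (h 0 (T.β' ∘ₗ φ)).comp_left T.β
    rwa [← LinearMap.comp_assoc, T.β'β, LinearMap.id_comp] at this
  | succ i ih => exact (T.ses i).SZ_mid (SZ_finsupp (h (i+2))) ih

lemma Tow.SZ_Y_of (n : ℕ) (h : ∀ i, n ≤ i → SZ A X (T.Z i)) : SZ A X T.Y := by
  intro φ
  obtain ⟨i, hi, ψ, rfl⟩ := fg_factor T.inj T.comm T.surj φ n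
  exact (h i hi ψ).comp_left _

lemma Tow.SZ_Y (h : ∀ j, SZ A X (R.C (j+1))) : SZ A X T.Y :=
  T.SZ_Y_of 0 fun i _ => T.SZ_of h i

variable [Module.Injective A A]

/-- (iv) -/
lemma Tow.SZ_CY (h : ∀ n, EX A (n+1) (R.C 0) (R.C 0)) (m : ℕ) : SZ A (R.C (m+2)) T.Y := by
  refine T.SZ_Y_of (m+1) fun i hi => ?_
  induction i, hi using Nat.le_induction with
  | base =>
    intro φ
    obtain ⟨ψ, ρ, hρ, rfl⟩ := (T.ses m).L1 (SZ_finsupp (R.SZ_lt h (by omega))) φ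
    obtain ⟨g, hg⟩ := T.kill m ψ
    rw [← hg]
    exact (FF_of _ _).add hρ
  | succ i hi ih => exact (T.ses i).SZ_mid (SZ_finsupp (R.SZ_lt h (by omega))) ih

/-- descent -/
lemma Tow.descent (h : ∀ n, EX A (n+1) (R.C 0) (R.C 0)) (i : ℕ) (ψ : R.C 1 →ₗ[A] T.Z i)
    (hψ : FF (T.ι i ∘ₗ ψ)) : FF ψ :=
  L3 (R.ses 1) (T.ses i) (SZ_finsupp (R.SZ_lt h (by omega))) ψ hψ

lemma Tow.descent_all (h : ∀ n, EX A (n+1) (R.C 0) (R.C 0)) (i : ℕ) :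
    ∀ (ψ : R.C 1 →ₗ[A] T.Z i), T.α i ∘ₗ ψ = T.α 0 ∘ₗ T.β → FF ψ → FF T.β := by
  induction i with
  | zero =>
    intro ψ hψ h
    have : ψ = T.β := by
      ext x; exact T.inj 0 (LinearMap.congr_fun hψ x)
    rwa [← this]
  | succ i ih =>
    intro ψ hψ hF
    -- build the composite at stage i
    have hex : ∀ j, ∃ χ : R.C 1 →ₗ[A] T.Z j, T.α j ∘ₗ χ = T.α 0 ∘ₗ T.β := by
      intro j
      induction j with
      | zero => exact ⟨T.β, rfl⟩
      | succ j ih =>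
        obtain ⟨χ, hχ⟩ := ih
        exact ⟨T.ι j ∘ₗ χ, by rw [← LinearMap.comp_assoc, T.comm, hχ]⟩
    obtain ⟨χ, hχ⟩ := hex i
    refine ih χ hχ (T.descent h i χ ?_)
    have : ψ = T.ι i ∘ₗ χ := by
      ext x
      apply T.inj (i+1)
      have h1 := LinearMap.congr_fun hψ x
      have h2 := LinearMap.congr_fun hχ x
      have h3 := LinearMap.congr_fun (T.comm i) (χ x)
      simp only [LinearMap.comp_apply] at h1 h2 h3 ⊢
      rw [h1, h3, h2]
    rwa [← this]

lemma Tow.conclude (h : ∀ n, EX A (n+1) (R.C 0) (R.C 0)) (hF : FF (T.α 0 ∘ₗ T.β)) :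
    Module.Projective A (R.C 0) := by
  have hβ : FF T.β := by
    obtain ⟨κ, _, a, b, hab⟩ := hF
    obtain ⟨i, -, ψ, rfl⟩ := fg_factor T.inj T.comm T.surj b 0
    exact T.descent_all h i (ψ ∘ₗ a) (by rw [hab]; rfl) (FF_of _ _)
  have hid : FF (LinearMap.id : R.C 1 →ₗ[A] R.C 1) := by
    have := hβ.comp_left T.β'
    rwa [T.ββ'] at this
  obtain ⟨s, -, hs⟩ := hid.lift (R.p 0) (R.ses 0).surj
  -- splitting
  obtain ⟨r, hr⟩ := (R.ses 0).liftKer (LinearMap.id - s ∘ₗ R.p 0) (by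
    rw [LinearMap.comp_sub, ← LinearMap.comp_assoc, hs]; simp)
  refine Module.Projective.of_split (R.i 0) r ?_
  ext x
  apply (R.ses 0).inj
  have h1 := LinearMap.congr_fun hr (R.i 0 x)
  simp only [LinearMap.comp_apply, LinearMap.sub_apply, LinearMap.id_apply] at h1 ⊢
  rw [h1, (R.ses 0).ex.apply_apply_eq_zero, map_zero, sub_zero]

end Tower
end Tach

namespace Tach

section Nu
variable {k A : Type} [Field k] [Ring A] [Algebra k A]

instance fieldInj : Module.Injective k k where
  out := by
    intro X Y _ _ _ _ f hf g
    obtain ⟨r, hr⟩ := f.exists_leftInverse_of_injective (LinearMap.ker_eq_bot.2 hf)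
    exact ⟨g ∘ₗ r, fun x => congrArg g (LinearMap.congr_fun hr x)⟩

variable {X Y Z : Type} [AddCommGroup X] [Module A X] [AddCommGroup Y] [Module A Y]
  [AddCommGroup Z] [Module A Z]

variable (k) in
/-- precomposition -/
def pre (f : X →ₗ[A] Y) : (Y →ₗ[A] A) →ₗ[k] (X →ₗ[A] A) where
  toFun g := g ∘ₗ f
  map_add' _ _ := rfl
  map_smul' _ _ := rfl

variable (k) in
/-- functoriality of nu -/
def numap (f : X →ₗ[A] Y) : NuCarrier k A X →ₗ[A] NuCarrier k A Y where
  toFun φ := φ ∘ₗ pre k f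
  map_add' _ _ := rfl
  map_smul' _ _ := rfl

lemma nu_smul_apply (a : A) (φ : NuCarrier k A X) (g : X →ₗ[A] A) :
    (a • φ) g = φ (rmulHom k A X a g) := rfl

lemma nu_ses [Module.Injective A A] {f : X →ₗ[A] Y} {g : Y →ₗ[A] Z} (h : SES f g) :
    SES (numap k f) (numap k g) where
  inj := by
    rw [← LinearMap.ker_eq_bot, LinearMap.ker_eq_bot']
    intro φ hφ
    refine LinearMap.ext fun u => ?_
    obtain ⟨v, rfl⟩ := inj_extend f h.inj u
    exact LinearMap.congr_fun hφ v
  surj := by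
    intro φ
    obtain ⟨u, hu⟩ := ext_of_ker (pre k g) φ (by
      intro v hv
      have : v = 0 := by
        ext z
        obtain ⟨y, rfl⟩ := h.surj z
        exact LinearMap.congr_fun hv y
      rw [this, map_zero])
    exact ⟨u, LinearMap.ext hu⟩
  ex := by
    intro φ
    constructor
    · intro hφ
      obtain ⟨u, hu⟩ := ext_of_ker (pre k f) φ (by
        intro v hv
        obtain ⟨w, rfl⟩ := h.desc v hv
        exact LinearMap.congr_fun hφ w)
      exact ⟨u, LinearMap.ext hu⟩
    · rintro ⟨ψ, rfl⟩
      refine LinearMap.ext fun v => ?_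
      have : pre k f (pre k g v) = 0 := by
        ext x
        change v (g (f x)) = 0
        rw [h.ex.apply_apply_eq_zero, map_zero]
      change ψ (pre k f (pre k g v)) = 0
      rw [this, map_zero]

lemma nu_algebraMap (c : k) (φ : NuCarrier k A X) (u : X →ₗ[A] A) :
    (algebraMap k A c • φ) u = c * φ u := by
  rw [nu_smul_apply]
  have : rmulHom k A X (algebraMap k A c) u = c • u := by
    ext x
    simp [Algebra.smul_def, Algebra.commutes]
  rw [this, map_smul, smul_eq_mul]

lemma fin_expand {d : ℕ} (u : (Fin d → A) →ₗ[A] A) :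
    u = ∑ j, rmulHom k A (Fin d → A) (u (Pi.single j 1)) (LinearMap.proj j) := by
  ext i
  simp [Pi.single_apply]

instance nu_free_inj {d : ℕ} : Module.Injective A (NuCarrier k A (Fin d → A)) where
  out := by
    intro X Y _ _ _ _ f hf g
    let : Module k X := Module.compHom X (algebraMap k A)
    let : Module k Y := Module.compHom Y (algebraMap k A)
    let fk : X →ₗ[k] Y := { f with map_smul' := fun c x => f.map_smul (algebraMap k A c) x }
    let θ : Fin d → X →ₗ[k] k := fun j =>
      { toFun := fun x => g x (LinearMap.proj j)
        map_add' := fun x y => by rw [map_add]; rfl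
        map_smul' := fun c x => by
          change g (algebraMap k A c • x) _ = _
          rw [map_smul, nu_algebraMap]; rfl }
    choose θ' hθ' using fun j => Module.Injective.out fk hf (θ j)
    refine ⟨{ toFun := fun y =>
                { toFun := fun u => ∑ j, θ' j (u (Pi.single j 1) • y)
                  map_add' := fun u v => by
                    simp [add_smul, Finset.sum_add_distrib]
                  map_smul' := fun c u => ?_ }
              map_add' := fun x y => ?_
              map_smul' := fun a y => ?_ }, fun x => ?_⟩
    · rw [RingHom.id_apply, Finset.smul_sum]
      refine Finset.sum_congr rfl fun j _ => ?_
      rw [← map_smul]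
      congr 1
      change _ = algebraMap k A c • (_ : Y)
      rw [LinearMap.smul_apply, smul_smul, Algebra.smul_def]
    · refine LinearMap.ext fun u => ?_
      change ∑ j, θ' j (u (Pi.single j 1) • (x + y)) =
        ∑ j, θ' j (u (Pi.single j 1) • x) + ∑ j, θ' j (u (Pi.single j 1) • y)
      simp [smul_add, Finset.sum_add_distrib]
    · refine LinearMap.ext fun u => ?_
      change ∑ j, θ' j (u (Pi.single j 1) • (a • y)) =
        ∑ j, θ' j ((u (Pi.single j 1) * a) • y)
      simp [mul_smul]
    · refine LinearMap.ext fun u => ?_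
      change ∑ j, θ' j (u (Pi.single j 1) • f x) = g x u
      conv_rhs => rw [fin_expand (k := k) u, map_sum]
      refine Finset.sum_congr rfl fun j _ => ?_
      rw [← map_smul]
      refine (hθ' j _).trans ?_
      change g (u (Pi.single j 1) • x) _ = _
      rw [map_smul, nu_smul_apply]

/-- the map `x ↦ g x • y` -/
def dot (y : Y) (g : X →ₗ[A] A) : X →ₗ[A] Y := LinearMap.toSpanSingleton A Y y ∘ₗ g

lemma nu_lift [Module.Injective A A] {C₀ C₁ C₂ : Type} [AddCommGroup C₀] [Module A C₀]
    [AddCommGroup C₁] [Module A C₁] [AddCommGroup C₂] [Module A C₂] {d e : ℕ}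
    {i₀ : C₀ →ₗ[A] (Fin d → A)} {p₀ : (Fin d → A) →ₗ[A] C₁} (h₀ : SES i₀ p₀)
    {i₁ : C₁ →ₗ[A] (Fin e → A)} {p₁ : (Fin e → A) →ₗ[A] C₂} (h₁ : SES i₁ p₁)
    (hY : SZ A C₂ Y) (ψ : Y →ₗ[A] NuCarrier k A C₁) :
    ∃ ψ' : Y →ₗ[A] NuCarrier k A (Fin d → A), numap k p₀ ∘ₗ ψ' = ψ := by
  let : Module k Y := Module.compHom Y (algebraMap k A)
  have : IsScalarTower k A Y := ⟨fun c a y => by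
    change (c • a) • y = algebraMap k A c • (a • y)
    rw [Algebra.smul_def, mul_smul]⟩
  have hk : ∀ (c : k) (y : Y), c • y = algebraMap k A c • y := fun c y => rfl
  let θ : ((Fin e → A) →ₗ[A] Y) →ₗ[k] k :=
    { toFun := fun u => ∑ j, ψ (u (Pi.single j 1)) (LinearMap.proj j ∘ₗ i₁)
      map_add' := fun u v => by
        simp only [LinearMap.add_apply, map_add, Finset.sum_add_distrib]
      map_smul' := fun c u => by
        rw [RingHom.id_apply, Finset.smul_sum]
        refine Finset.sum_congr rfl fun j _ => ?_
        rw [LinearMap.smul_apply, hk, map_smul, nu_algebraMap, smul_eq_mul] }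
  have hθ : ∀ y f, θ (dot y f) = ψ y (f ∘ₗ i₁) := by
    intro y f
    change ∑ j, ψ (f (Pi.single j 1) • y) (LinearMap.proj j ∘ₗ i₁) = _
    have : f ∘ₗ i₁ = ∑ j, rmulHom k A C₁ (f (Pi.single j 1)) (LinearMap.proj j ∘ₗ i₁) := by
      ext x
      have := LinearMap.congr_fun (fin_expand (k := k) f) (i₁ x)
      rw [LinearMap.comp_apply, this]
      simp [LinearMap.sum_apply]
    rw [this, map_sum]
    refine Finset.sum_congr rfl fun j _ => ?_
    rw [map_smul, nu_smul_apply]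
  let δ : ((Fin e → A) →ₗ[A] Y) →ₗ[k] ((Fin d → A) →ₗ[A] Y) :=
    { toFun := fun u => u ∘ₗ i₁ ∘ₗ p₀
      map_add' := fun _ _ => rfl
      map_smul' := fun _ _ => rfl }
  obtain ⟨θ', hθ'⟩ := ext_of_ker δ θ (by
    intro u hu
    have hu1 : u ∘ₗ i₁ = 0 := by
      ext z
      obtain ⟨x, rfl⟩ := h₀.surj z
      exact LinearMap.congr_fun hu x
    obtain ⟨w, rfl⟩ := h₁.desc u hu1
    obtain ⟨κ, _, a, b, rfl⟩ := hY w
    classical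
    have e1 : (b ∘ₗ a) ∘ₗ p₁ = ∑ l, dot (b (Pi.single l 1)) (LinearMap.proj l ∘ₗ a ∘ₗ p₁) := by
      refine LinearMap.ext fun x => ?_
      rw [LinearMap.sum_apply]
      change b (a (p₁ x)) = _
      rw [LinearMap.pi_apply_eq_sum_univ b]
      refine Finset.sum_congr rfl fun l _ => ?_
      change _ = (a (p₁ x)) l • b (Pi.single l 1)
      congr 2
      ext m
      simp [Pi.single_apply, eq_comm]
    rw [e1, map_sum]
    refine Finset.sum_eq_zero fun l _ => ?_
    rw [hθ, LinearMap.comp_assoc, LinearMap.comp_assoc, h₁.ex.linearMap_comp_eq_zero]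
    simp)
  refine ⟨{ toFun := fun y =>
              { toFun := fun g => θ' (dot y g)
                map_add' := fun u v => ?_
                map_smul' := fun c u => ?_ }
            map_add' := fun x y => ?_
            map_smul' := fun a y => ?_ }, ?_⟩
  · rw [← map_add]; congr 1; ext; simp [dot, add_smul]
  · rw [RingHom.id_apply, ← map_smul]; congr 1
    refine LinearMap.ext fun x => ?_
    change (c • u x) • y = c • (u x • y)
    rw [smul_assoc]
  · refine LinearMap.ext fun u => ?_
    change θ' (dot (x + y) u) = θ' (dot x u) + θ' (dot y u)
    rw [← map_add]; congr 1; ext; simp [dot, smul_add]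
  · refine LinearMap.ext fun u => ?_
    change θ' (dot (a • y) u) = θ' (dot y (rmulHom k A _ a u))
    congr 1; ext; simp [dot, mul_smul]
  · refine LinearMap.ext fun y => LinearMap.ext fun f => ?_
    obtain ⟨f', rfl⟩ := inj_extend i₁ h₁.inj f
    change θ' (dot y ((f' ∘ₗ i₁) ∘ₗ p₀)) = _
    rw [← hθ]
    exact hθ' (dot y f')

lemma EX_nu [Module.Injective A A] (R : CoRes A) (hY : ∀ m, SZ A (R.C (m+2)) Y) (n : ℕ) :
    ∀ j, EX A (n+1) Y (NuCarrier k A (R.C j)) := by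
  induction n with
  | zero =>
    intro j
    exact (nu_ses (R.ses j)).EX_one_right fun φ =>
      nu_lift (R.ses j) (R.ses (j+1)) (hY j) φ
  | succ n ih =>
    intro j
    exact ((nu_ses (k := k) (R.ses j)).shift_right n).2 (ih (j+1))

end Nu
end Tach

namespace Tach

section Fin
variable {A : Type} [Ring A]

lemma filt_factor [IsNoetherianRing A] {J : Type} [SmallCategory J] [IsFiltered J]
    (F : J ⥤ ModuleCat.{0} A) (c : Limits.Cocone F) (hc : Limits.IsColimit c)
    {X : Type} [AddCommGroup X] [Module A X] [Module.Finite A X] (φ : X →ₗ[A] c.pt) :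
    ∃ (j : J) (ψ : X →ₗ[A] F.obj j), φ = (c.ι.app j).hom ∘ₗ ψ := by
  classical
  obtain ⟨n, π, hπ⟩ := Module.Finite.exists_fin' A X
  have hrep : ∀ i : Fin n, ∃ j : J, ∃ x : F.obj j, c.ι.app j x = φ (π (Pi.single i 1)) :=
    fun i => Limits.Concrete.isColimit_exists_rep F hc _
  choose s x hx using hrep
  obtain ⟨j, hj⟩ := IsFiltered.sup_objs_exists (Finset.univ.image s)
  let f : ∀ i, s i ⟶ j := fun i => (hj (Finset.mem_image_of_mem s (Finset.mem_univ i))).some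
  let g : (Fin n → A) →ₗ[A] F.obj j :=
    Fintype.linearCombination A fun i => F.map (f i) (x i)
  have hg : (c.ι.app j).hom ∘ₗ g = φ ∘ₗ π := by
    refine LinearMap.pi_ext' fun i => LinearMap.ext_ring ?_
    have h1 : g (Pi.single i 1) = F.map (f i) (x i) := by
      simp [g, Fintype.linearCombination_apply_single]
    change c.ι.app j (g (Pi.single i 1)) = φ (π (Pi.single i 1))
    rw [h1, ← hx i]
    have := c.w (f i)
    exact ConcreteCategory.congr_hom this (x i)
  have hkill : ∀ S : Finset (Fin n → A), (∀ κ ∈ S, π κ = 0) →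
      ∃ (j' : J) (u : j ⟶ j'), ∀ κ ∈ S, F.map u (g κ) = 0 := by
    intro S
    induction S using Finset.induction_on with
    | empty => intro _; exact ⟨j, 𝟙 j, by simp⟩
    | insert κ S hκ ih =>
      intro h
      obtain ⟨j', u, hu⟩ := ih fun κ' h' => h κ' (Finset.mem_insert_of_mem h')
      have h0 : c.ι.app j' (F.map u (g κ)) = c.ι.app j' 0 := by
        have h1 := ConcreteCategory.congr_hom (c.w u) (g κ)
        have h2 := LinearMap.congr_fun hg κ
        have h3 := h κ (Finset.mem_insert_self _ _)
        rw [map_zero]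
        refine h1.trans (h2.trans ?_)
        rw [LinearMap.comp_apply, h3, map_zero]
      obtain ⟨j'', v, w, hvw⟩ := Limits.Concrete.isColimit_exists_of_rep_eq F hc _ _ h0
      refine ⟨j'', u ≫ v, fun κ' h' => ?_⟩
      rw [F.map_comp]
      change F.map v (F.map u (g κ')) = 0
      rcases Finset.mem_insert.1 h' with rfl | h'
      · rw [hvw, map_zero]
      · rw [hu κ' h', map_zero]
  obtain ⟨S, hS⟩ := IsNoetherian.noetherian (LinearMap.ker π)
  obtain ⟨j', u, hu⟩ := hkill S fun κ hκ => by
    have : κ ∈ LinearMap.ker π := by rw [← hS]; exact Submodule.subset_span hκ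
    exact this
  have hs : SES (LinearMap.ker π).subtype π :=
    ⟨Submodule.subtype_injective _, hπ, LinearMap.exact_subtype_ker_map π⟩
  obtain ⟨ψ, hψ⟩ := hs.desc ((F.map u).hom ∘ₗ g) (by
    refine LinearMap.ext fun z => ?_
    have hle : LinearMap.ker π ≤ LinearMap.ker ((F.map u).hom ∘ₗ g) := by
      rw [← hS, Submodule.span_le]
      exact fun κ hκ => hu κ hκ
    exact hle z.2)
  refine ⟨j', ψ, ?_⟩
  ext y
  obtain ⟨z, rfl⟩ := hπ y
  have h1 := LinearMap.congr_fun hψ z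
  have h2 := LinearMap.congr_fun hg z
  have h3 := ConcreteCategory.congr_hom (c.w u) (g z)
  simp only [LinearMap.comp_apply] at h1 h2 ⊢
  rw [h1, ← h2]
  exact h3.symm

/-- functor of f.g. submodules -/
def fgF (X : ModuleCat.{0} A) : {N : Submodule A X // N.FG} ⥤ ModuleCat.{0} A where
  obj N := ModuleCat.of A N.1
  map f := ModuleCat.ofHom (Submodule.inclusion (leOfHom f))

instance (X : ModuleCat.{0} A) : Nonempty {N : Submodule A X // N.FG} := ⟨⟨⊥, Submodule.fg_bot⟩⟩

instance (X : ModuleCat.{0} A) : IsDirectedOrder {N : Submodule A X // N.FG} :=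
  ⟨fun a b => ⟨⟨a.1 ⊔ b.1, a.2.sup b.2⟩, le_sup_left (a := a.1), le_sup_right (b := b.1)⟩⟩

lemma fg_colim (X : ModuleCat.{0} A) : Nonempty (Limits.colimit (fgF X) ≅ X) := by
  let c : Limits.Cocone (fgF X) :=
    { pt := X
      ι := { app := fun N => ModuleCat.ofHom N.1.subtype
             naturality := fun _ _ _ => rfl } }
  let d := Limits.colimit.desc (fgF X) c
  have hd : ∀ (N : {N : Submodule A X // N.FG}) (x : N.1),
      d (Limits.colimit.ι (fgF X) N x) = x.1 := fun N x =>
    ConcreteCategory.congr_hom (Limits.colimit.ι_desc c N) x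
  have hb : Function.Bijective d.hom := by
    constructor
    · rw [← LinearMap.ker_eq_bot, LinearMap.ker_eq_bot']
      intro y hy
      obtain ⟨N, x, rfl⟩ := Limits.Concrete.colimit_exists_rep (fgF X) y
      have h1 := hd N x
      have h2 : x = 0 := Subtype.ext (h1.symm.trans hy)
      rw [h2, map_zero]
    · intro x
      exact ⟨Limits.colimit.ι (fgF X) ⟨Submodule.span A {x}, Submodule.fg_span_singleton x⟩
        ⟨x, Submodule.mem_span_singleton_self x⟩, hd _ _⟩
  exact ⟨(LinearEquiv.ofBijective d.hom hb).toModuleIso⟩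

lemma inj_of_proj [Module.Injective A A] (M : Type) [AddCommGroup M] [Module A M]
    [Module.Finite A M] [Module.Projective A M] : Module.Injective A M where
  out := by
    intro X Y _ _ _ _ f hf g
    obtain ⟨n, π, hπ⟩ := Module.Finite.exists_fin' A M
    obtain ⟨s, hs⟩ := Module.projective_lifting_property π LinearMap.id hπ
    obtain ⟨u, hu⟩ := inj_extend f hf (s ∘ₗ g)
    refine ⟨π ∘ₗ u, fun x => ?_⟩
    have h1 := LinearMap.congr_fun hu x
    have h2 := LinearMap.congr_fun hs (g x)
    simp only [LinearMap.comp_apply, LinearMap.id_apply] at h1 h2 ⊢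
    rw [h1, h2]

lemma memG_of_proj [Module.Injective A A] (M : ModuleCat.{0} A) [Module.Finite A M]
    [Module.Projective A M] (X : ModuleCat.{0} A) : MemG A M X := by
  intro n hn
  obtain ⟨n, rfl⟩ := Nat.exists_eq_add_of_le' hn
  have := inj_of_proj (A := A) M
  exact ⟨(extZero_iff n M X).2 (EX_proj (X := M) (Y := X) n),
    (extZero_iff n X M).2 (EX_inj (X := X) (Y := M) n)⟩

lemma filt_of_proj [Module.Injective A A] (M : ModuleCat.{0} A) [Module.Finite A M]
    [Module.Projective A M] (X : ModuleCat.{0} A) : FiltColimOfFgG A M X := by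
  have key : ∃ c : Limits.Cocone (fgF X), Nonempty (Limits.IsColimit c) ∧ Nonempty (c.pt ≅ X) :=
    ⟨Limits.colimit.cocone (fgF X), ⟨Limits.colimit.isColimit _⟩, fg_colim X⟩
  obtain ⟨c, hc, he⟩ := key
  refine ⟨Cat.of {N : Submodule A X // N.FG}, ?_, fgF X, c, ?_, hc, he⟩
  · change IsFiltered {N : Submodule A X // N.FG}
    infer_instance
  · intro N
    refine ⟨?_, memG_of_proj M _⟩
    exact Module.Finite.iff_fg.2 N.2

variable {k : Type} [Field k] [Algebra k A] [FiniteDimensional k A] [Module.Injective A A]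

lemma memG_Y (R : CoRes A) (T : Tow R) (h : ∀ n, EX A (n+1) (R.C 0) (R.C 0))
    (hns : NakayamaStable k A (R.C 0)) : MemG A (R.C 0) T.Y := by
  have : IsNoetherian A A := isNoetherian_of_tower k inferInstance
  have : IsNoetherianRing A := this
  intro n hn
  obtain ⟨n, rfl⟩ := Nat.exists_eq_add_of_le' hn
  refine ⟨(extZero_iff n _ _).2 ?_, (extZero_iff n _ _).2 ?_⟩
  · refine EX_of_SZ (M := R.C 0) (Y := T.Y) ?_ n (R.C 0) h
    intro X _ _ _ hX
    exact T.SZ_Y (R.SZ_C hX)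
  · have h1 : MemAdd A (R.C 0) (R.C 0) :=
      ⟨1, ModuleCat.of A PUnit, ⟨(LinearEquiv.prodUnique (R := A)).trans
        (LinearEquiv.funUnique (Fin 1) A (R.C 0)).symm⟩⟩
    obtain ⟨m, Y', ⟨e0⟩⟩ := (hns _).1 h1
    let e : (R.C 0 × Y') ≃ₗ[A] (Fin m → NuCarrier k A (R.C 0)) := e0
    have hnu : EX A (n+1) T.Y (NuCarrier k A (R.C 0)) := EX_nu R (T.SZ_CY h) n 0
    refine EX_summand (X := R.C 0) (Y := T.Y) (Z := NuCarrier k A (R.C 0)) (n+1) (m := m)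
      (fun i => LinearMap.proj i ∘ₗ e.toLinearMap ∘ₗ LinearMap.inl A (R.C 0) Y')
      (fun i => LinearMap.fst A (R.C 0) Y' ∘ₗ e.symm.toLinearMap ∘ₗ
        LinearMap.single A (fun _ : Fin m => NuCarrier k A (R.C 0)) i) ?_ hnu
    refine LinearMap.ext fun x => ?_
    rw [LinearMap.sum_apply]
    have h2 : ∑ i, e.symm (Pi.single i (e (x, 0) i)) = (x, 0) := by
      rw [← map_sum, Finset.univ_sum_single, LinearEquiv.symm_apply_apply]
    have h3 := congrArg (LinearMap.fst A (R.C 0) Y') h2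
    rw [map_sum] at h3
    exact h3

lemma proj_of_filt (R : CoRes A) (h : ∀ n, EX A (n+1) (R.C 0) (R.C 0))
    (hns : NakayamaStable k A (R.C 0))
    (H : ∀ X : ModuleCat.{0} A, MemG A (R.C 0) X ↔ FiltColimOfFgG A (R.C 0) X) :
    Module.Projective A (R.C 0) := by
  have : IsNoetherian A A := isNoetherian_of_tower k inferInstance
  have : IsNoetherianRing A := this
  obtain ⟨T⟩ := exists_tow R
  obtain ⟨J, hJ, F, c, hF, ⟨hc⟩, ⟨e⟩⟩ := (H T.Y).1 (memG_Y (k := k) R T h hns)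
  apply T.conclude h
  obtain ⟨j, ψ, hψ⟩ := filt_factor F c hc (e.inv.hom ∘ₗ T.α 0 ∘ₗ T.β)
  have hfin := (hF j).1
  have hG := (hF j).2
  have hE : ∀ n, EX A (n+1) (F.obj j) (R.C 0) := fun n =>
    (extZero_iff n _ _).1 (hG (n+1) (by omega)).2
  have hFF : FF (e.hom.hom ∘ₗ (c.ι.app j).hom) := T.SZ_Y (R.SZ_C hE) _
  have := hFF.comp_right ψ
  rw [LinearMap.comp_assoc, ← hψ] at this
  have e2 : e.hom.hom ∘ₗ e.inv.hom ∘ₗ T.α 0 ∘ₗ T.β = T.α 0 ∘ₗ T.β := by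
    refine LinearMap.ext fun x => ?_
    exact ConcreteCategory.congr_hom e.inv_hom_id (T.α 0 (T.β x))
  rwa [e2] at this

end Fin
end Tach

/-- **Theorem 1.2, (1) ⇔ (2)**. Let `A` be a finite-dimensional self-injective algebra over a
field `k` and `M` a finitely generated, self-orthogonal, Nakayama-stable generator. Then `M` is
projective iff `𝒢` coincides with the class of all filtered colimits of finitely generated
modules lying in `𝒢`. -/
theorem tachikawa_second_conjecture_iff_filtered_colimits
    (k A : Type) [Field k] [Ring A] [Algebra k A] [FiniteDimensional k A]
    [Module.Injective A A]
    (M : ModuleCat.{0} A) [Module.Finite A ↥M]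
    (hgen : IsGen A M) (hso : SelfOrthogonal A M) (hns : NakayamaStable k A M) :
    Module.Projective A ↥M ↔
      ∀ X : ModuleCat.{0} A, MemG A M X ↔ FiltColimOfFgG A M X := by
  constructor
  · intro hP X
    exact iff_of_true (Tach.memG_of_proj M X) (Tach.filt_of_proj M X)
  · intro H
    obtain ⟨R, rfl⟩ := Tach.exists_cores k M
    exact Tach.proj_of_filt (k := k) R
      (fun n => (Tach.extZero_iff n _ _).1 (hso (n+1) (by omega))) hns H
end

section
/- Let k be a field, A a finite-dimensional self-injective k-algebra, and M a finitely generated generator for A-mod. Then every left A-module X (not necessarily finitely generated) admits a minimal right Add(M)-approximation and a minimal left Add(M)-approximation. (Remark 3.2(2).) -/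
open CategoryTheory
theorem aux_compl (R F : Type) [Ring R] [IsSemiprimaryRing R] [AddCommGroup F] [Module R F]
    (K : Submodule R F) :
    ∃ C : Submodule R F, K ⊔ C = ⊤ ∧ K ⊓ C ≤ Ring.jacobson R • (⊤ : Submodule R F) ∧
      Ring.jacobson R • (⊤ : Submodule R F) ≤ C := by
  set N := Ring.jacobson R • (⊤ : Submodule R F) with hN
  have ht : Module.IsTorsionBySet R (F ⧸ N) (Ring.jacobson R) := by
    rw [Module.isTorsionBySet_quotient_iff]
    exact fun m i hi ↦ Submodule.smul_mem_smul hi trivial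
  let _ := ht.module
  have hs : IsSemisimpleModule R (F ⧸ N) :=
    (ht.semilinearMap.isSemisimpleModule_iff_of_bijective Function.bijective_id).2 inferInstance
  obtain ⟨D, hD⟩ := exists_isCompl (K.map N.mkQ)
  have hle : N ≤ D.comap N.mkQ := by
    intro x hx
    have : N.mkQ x = 0 := by simpa using hx
    simp [Submodule.mem_comap, this]
  refine ⟨D.comap N.mkQ, ?_, ?_, hle⟩
  · rw [eq_top_iff]
    intro x _
    have : N.mkQ x ∈ K.map N.mkQ ⊔ D := by rw [hD.sup_eq_top]; trivial
    obtain ⟨y, ⟨z, hz, rfl⟩, d, hd, h⟩ := Submodule.mem_sup.1 this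
    refine Submodule.mem_sup.2 ⟨z, hz, x - z, ?_, by abel⟩
    rw [Submodule.mem_comap, map_sub, ← h]
    simpa using hd
  · rintro x ⟨h1, h2⟩
    have : N.mkQ x ∈ K.map N.mkQ ⊓ D := ⟨⟨x, h1, rfl⟩, h2⟩
    rw [hD.inf_eq_bot] at this
    simpa using this

theorem aux_st (R F : Type) [Ring R] [AddCommGroup F] [Module R F] (J : Ideal R)
    (b : F →ₗ[R] F) (h : F) (hh : h ∈ (J • ⊤ : Submodule R F)) : b h ∈ (J • ⊤ : Submodule R F) := by
  have : (J • ⊤ : Submodule R F).map b ≤ J • ⊤ := by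
    rw [Submodule.map_smul'']
    exact smul_mono_right _ le_top
  exact this ⟨h, hh, rfl⟩

theorem aux_map (R F : Type) [Ring R] [AddCommGroup F] [Module R F] (J : Ideal R)
    (b : F →ₗ[R] F) (hb : ∀ h, b h ∈ (J • ⊤ : Submodule R F)) (n : ℕ) (h : F) :
    b^[n] h ∈ (J ^ n • ⊤ : Submodule R F) := by
  induction n with
  | zero => rw [J.pow_zero, Ideal.one_eq_top]; simp
  | succ n ih =>
    have h1 : (J ^ n • ⊤ : Submodule R F).map b ≤ J ^ (n+1) • ⊤ := by
      rw [Submodule.map_smul'', J.pow_succ, Submodule.mul_smul]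
      apply smul_mono_right
      rintro _ ⟨h, _, rfl⟩
      exact hb h
    rw [Function.iterate_succ_apply']
    exact h1 ⟨_, ih, rfl⟩

theorem aux_art (k A M : Type) [Field k] [Ring A] [Algebra k A] [FiniteDimensional k A]
    [AddCommGroup M] [Module A M] [Module k M] [IsScalarTower k A M] [Module.Finite A M] :
    IsSemiprimaryRing (Module.End A M)ᵈᵐᵃ := by
  have : Module.Finite k M := Module.Finite.trans A M
  have h1 : Module.Finite k (Module.End A M) := 
    Module.Finite.of_injective (LinearMap.restrictScalarsₗ k A M M k) (LinearMap.restrictScalars_injective k)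
  have h2 : IsArtinianRing (Module.End A M)ᵐᵒᵖ := IsArtinianRing.of_finite k _
  have : IsArtinianRing (Module.End A M)ᵈᵐᵃ := h2
  infer_instance

theorem right_core (k A M X I : Type) [Field k] [Ring A] [Algebra k A] [FiniteDimensional k A]
    [AddCommGroup M] [Module A M] [Module k M] [IsScalarTower k A M] [Module.Finite A M]
    [AddCommGroup X] [Module A X] (f : (I →₀ M) →ₗ[A] X) :
    ∃ e : Module.End A (I →₀ M), e * e = e ∧ f ∘ₗ e = f ∧
      ∀ γ : Module.End A (I →₀ M), f ∘ₗ γ = 0 → e * γ = γ → IsNilpotent γ := by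
  classical
  have hsp := aux_art k A M
  let R := (Module.End A M)ᵈᵐᵃ
  let F := M →ₗ[A] (I →₀ M)
  let q : F →ₗ[R] (M →ₗ[A] X) := 
    { toFun := fun h => f ∘ₗ h
      map_add' := fun x y => LinearMap.comp_add _ _ _
      map_smul' := fun r x => rfl }
  let post : Module.End A (I →₀ M) → (F →ₗ[R] F) := fun β =>
    { toFun := fun h => β ∘ₗ h
      map_add' := fun x y => LinearMap.comp_add _ _ _
      map_smul' := fun r x => rfl }
  let J := Ring.jacobson R
  let N : Submodule R F := J • ⊤
  -- span
  have hspan : ∀ S : Submodule R F, (∀ i, (Finsupp.lsingle i : F) ∈ S) → ∀ h, h ∈ S := by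
    intro S hS h
    have hfin : ∃ s : Finset I, ∀ m, (h m).support ⊆ s := by
      obtain ⟨G, hG⟩ := (inferInstance : Module.Finite A M).fg_top
      refine ⟨G.biUnion fun g => (h g).support, fun m => ?_⟩
      have hm : m ∈ Submodule.span A (G : Set M) := by rw [hG]; trivial
      induction hm using Submodule.span_induction with
      | mem x hx => exact Finset.subset_biUnion_of_mem (fun g => (h g).support) hx
      | zero => simp
      | add x y _ _ hx hy =>
        rw [map_add]; exact Finsupp.support_add.trans (Finset.union_subset hx hy)
      | smul a x _ hx => rw [map_smul]; exact Finsupp.support_smul.trans hx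
    obtain ⟨s, hs⟩ := hfin
    have : h = ∑ i ∈ s, (DomMulAct.mk (Finsupp.lapply i ∘ₗ h : Module.End A M) : R) • (Finsupp.lsingle i : F) := by
      ext1 m
      rw [LinearMap.sum_apply]
      simp only [DomMulAct.mk_smul_linearMap_apply]
      change h m = ∑ i ∈ s, Finsupp.single i (h m i)
      conv_lhs => rw [← Finsupp.sum_single (h m)]
      exact Finsupp.sum_of_support_subset _ (hs m) _ (by simp)
    rw [this]
    exact Submodule.sum_mem _ fun i _ => S.smul_mem _ (hS i)
  have hNst : ∀ β : Module.End A (I →₀ M), ∀ h ∈ N, (β ∘ₗ h : F) ∈ N := by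
    intro β h hh
    exact aux_st R F J (post β) h hh
  have hnil : ∀ β : Module.End A (I →₀ M), (∀ h : F, (β ∘ₗ h : F) ∈ N) → IsNilpotent β := by
    intro β hβ
    obtain ⟨n, hn⟩ := IsSemiprimaryRing.isNilpotent (R := R)
    refine ⟨n, ?_⟩
    have hp : ∀ m (h : F), (fun g : F => (β ∘ₗ g : F))^[m] h = (β ^ m) ∘ₗ h := by
      intro m h
      induction m with
      | zero => rfl
      | succ m ih => rw [Function.iterate_succ_apply', pow_succ', ih]; rfl
    have h0 : ∀ h : F, (β ^ n) ∘ₗ h = 0 := by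
      intro h
      have := aux_map R F (Ring.jacobson R) (post β) hβ n h
      rw [hn] at this
      rw [← hp]
      simp only [Submodule.zero_eq_bot, Submodule.bot_smul, Submodule.mem_bot] at this
      exact this
    ext1 i
    exact h0 (Finsupp.lsingle i)
  obtain ⟨C, hC1, hC2, hC3⟩ := aux_compl R F (LinearMap.ker q)
  have hdec : ∀ i : I, ∃ κ : F, f ∘ₗ κ = 0 ∧ (Finsupp.lsingle i : F) - κ ∈ C := by
    intro i
    have : (Finsupp.lsingle i : F) ∈ LinearMap.ker q ⊔ C := by rw [hC1]; trivial
    obtain ⟨κ, h1, c, h2, h3⟩ := Submodule.mem_sup.1 this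
    refine ⟨κ, h1, ?_⟩
    rw [← h3]; simpa using h2
  choose κ hκ1 hκ2 using hdec
  let α : Module.End A (I →₀ M) := Finsupp.lsum ℕ κ
  have hα : ∀ i, α ∘ₗ Finsupp.lsingle i = κ i := by
    intro i; ext1 m; simp [α]
  have hfα : f ∘ₗ α = 0 := by
    ext1 i
    rw [LinearMap.comp_assoc, hα, hκ1, LinearMap.zero_comp]
  have hαC : ∀ h : F, h - (α ∘ₗ h : F) ∈ C := by
    intro h
    have := hspan (C.comap (LinearMap.id - post α)) (fun i => by
      change (Finsupp.lsingle i : F) - α ∘ₗ (Finsupp.lsingle i : F) ∈ C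
      rw [hα]; exact hκ2 i) h
    exact this
  have hαK : ∀ h : F, f ∘ₗ h = 0 → h - (α ∘ₗ h : F) ∈ N := by
    intro h hh
    refine hC2 ⟨?_, hαC h⟩
    change f ∘ₗ (h - α ∘ₗ h) = 0
    rw [LinearMap.comp_sub, hh, ← LinearMap.comp_assoc, hfα]; simp
  obtain ⟨n, hn⟩ : IsNilpotent (α * (1 - α)) := by
    refine hnil _ fun h => ?_
    have := hαK (α ∘ₗ h) (by rw [← LinearMap.comp_assoc, hfα]; simp)
    convert this using 1
    rw [mul_sub, mul_one]; rfl
  have hn : (α * (1 - α)) ^ (n+1) = 0 := by rw [pow_succ, hn, zero_mul]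
  have hcomm : Commute α (1 - α) := (Commute.one_right α).sub_right (Commute.refl α)
  rw [hcomm.mul_pow] at hn
  have hcop : IsCoprime ((Polynomial.X : Polynomial ℤ) ^ (n+1)) ((1 - Polynomial.X) ^ (n+1)) :=
    IsCoprime.pow ⟨1, 1, by ring⟩
  obtain ⟨a, b, hab⟩ := hcop
  have hab' := congrArg (Polynomial.aeval α) hab
  simp only [map_add, map_mul, map_pow, map_sub, map_one, Polynomial.aeval_X] at hab'
  set a' := Polynomial.aeval α a
  set b' := Polynomial.aeval α b
  have ca : Commute α a' := by
    have := congrArg (Polynomial.aeval α) (mul_comm Polynomial.X a)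
    simpa [Commute, SemiconjBy] using this
  have cb : Commute α b' := by
    have := congrArg (Polynomial.aeval α) (mul_comm Polynomial.X b)
    simpa [Commute, SemiconjBy] using this
  have hαe : α ^ (n+1) * (b' * (1 - α) ^ (n+1)) = 0 := by
    rw [← mul_assoc, (cb.pow_left (n+1)).eq, mul_assoc, hn, mul_zero]
  have h1e : b' * (1 - α) ^ (n+1) = 1 - a' * α ^ (n+1) := eq_sub_of_add_eq' hab'
  refine ⟨b' * (1 - α) ^ (n+1), ?_, ?_, ?_⟩
  · nth_rewrite 1 [h1e]
    rw [sub_mul, one_mul, mul_assoc, hαe, mul_zero, sub_zero]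
  · rw [h1e, ← (ca.pow_left (n+1)).eq, pow_succ', mul_assoc]
    rw [LinearMap.comp_sub, Module.End.mul_eq_comp α, ← LinearMap.comp_assoc, hfα, LinearMap.zero_comp, sub_zero]; rfl
  · intro γ h1 h2
    refine hnil _ fun h => ?_
    have h3 : ∀ m : ℕ, (γ ∘ₗ h : F) - (α ^ m) ∘ₗ (γ ∘ₗ h : F) ∈ N := by
      intro m
      induction m with
      | zero => 
        have : (γ ∘ₗ h : F) - (α ^ 0) ∘ₗ (γ ∘ₗ h : F) = 0 := by rw [pow_zero]; exact sub_self _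
        rw [this]; exact N.zero_mem
      | succ m ih =>
        have h4 := hαK (γ ∘ₗ h) (by rw [← LinearMap.comp_assoc, h1]; simp)
        have h5 := N.add_mem h4 (hNst α _ ih)
        convert h5 using 1
        rw [LinearMap.comp_sub, pow_succ']
        change _ = _ - _ + (_ - (α * α ^ m) ∘ₗ (γ ∘ₗ h))
        abel
    have h6 := h3 (n+1)
    have h7 : (α ^ (n+1)) ∘ₗ (γ ∘ₗ h : F) = 0 := by
      change (α ^ (n+1) * γ) ∘ₗ h = 0
      rw [← h2, ← mul_assoc, hαe, zero_mul]; simp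
    rw [h7, sub_zero] at h6
    exact h6


theorem aux_idem {E : Type} [Ring E] (α : E) (h : IsNilpotent (α * (1 - α))) :
    ∃ (n : ℕ) (e c : E), e * e = e ∧ e = 1 - α * c ∧ e = 1 - c * α ∧ α ^ n * e = 0 ∧ e * α ^ n = 0 := by
  obtain ⟨n, hn⟩ := h
  have hn : (α * (1 - α)) ^ (n+1) = 0 := by rw [pow_succ, hn, zero_mul]
  have hcomm : Commute α (1 - α) := (Commute.one_right α).sub_right (Commute.refl α)
  rw [hcomm.mul_pow] at hn
  have hcop : IsCoprime ((Polynomial.X : Polynomial ℤ) ^ (n+1)) ((1 - Polynomial.X) ^ (n+1)) :=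
    IsCoprime.pow ⟨1, 1, by ring⟩
  obtain ⟨a, b, hab⟩ := hcop
  have hab' := congrArg (Polynomial.aeval α) hab
  simp only [map_add, map_mul, map_pow, map_sub, map_one, Polynomial.aeval_X] at hab'
  set a' := Polynomial.aeval α a
  set b' := Polynomial.aeval α b
  have ca : Commute α a' := by
    have := congrArg (Polynomial.aeval α) (mul_comm Polynomial.X a)
    simpa [Commute, SemiconjBy] using this
  have cb : Commute α b' := by
    have := congrArg (Polynomial.aeval α) (mul_comm Polynomial.X b)
    simpa [Commute, SemiconjBy] using this
  have hαe : α ^ (n+1) * (b' * (1 - α) ^ (n+1)) = 0 := by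
    rw [← mul_assoc, (cb.pow_left (n+1)).eq, mul_assoc, hn, mul_zero]
  have h1e : b' * (1 - α) ^ (n+1) = 1 - a' * α ^ (n+1) := eq_sub_of_add_eq' hab'
  have hc : Commute (α ^ (n+1)) (b' * (1 - α) ^ (n+1)) :=
    (cb.pow_left _).mul_right ((hcomm.pow_right _).pow_left _)
  have hc2 : Commute α (a' * α ^ n) := ca.mul_right ((Commute.refl α).pow_right n)
  refine ⟨n+1, b' * (1 - α) ^ (n+1), a' * α ^ n, ?_, ?_, ?_, hαe, ?_⟩
  · nth_rewrite 1 [h1e]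
    rw [sub_mul, one_mul, mul_assoc, hαe, mul_zero, sub_zero]
  · rw [h1e, hc2.eq, mul_assoc, pow_succ]
  · rw [h1e, mul_assoc, pow_succ]
  · rw [← hc.eq, hαe]

theorem aux_compl2 (R D : Type) [Ring R] [IsSemiprimaryRing R] [AddCommGroup D] [Module R D]
    (N S : Submodule R D) (hS : ∀ q ∈ S, ∀ r ∈ Ring.jacobson R, r • q = 0) :
    ∃ S' : Submodule R D, S' ≤ S ∧ Disjoint N S' ∧ S ≤ N ⊔ S' := by
  have ht : Module.IsTorsionBySet R S (Ring.jacobson R) := by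
    intro q r
    exact Subtype.ext (hS q q.2 r r.2)
  let _ := ht.module
  have hs : IsSemisimpleModule R S :=
    (ht.semilinearMap.isSemisimpleModule_iff_of_bijective Function.bijective_id).2 inferInstance
  obtain ⟨T, hT⟩ := exists_isCompl (N.comap S.subtype)
  refine ⟨T.map S.subtype, Submodule.map_subtype_le _ _, ?_, ?_⟩
  · rw [Submodule.disjoint_def]
    rintro _ hx ⟨y, hy, rfl⟩
    have := (Submodule.disjoint_def.1 hT.disjoint) y hx hy
    rw [this]; simp
  · intro x hx
    have : (⟨x, hx⟩ : S) ∈ N.comap S.subtype ⊔ T := by rw [hT.sup_eq_top]; trivial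
    obtain ⟨y, hy, z, hz, h⟩ := Submodule.mem_sup.1 this
    exact Submodule.mem_sup.2 ⟨y, hy, z, ⟨z, hz, rfl⟩, congrArg Subtype.val h⟩

theorem aux_proj (k V : Type) [Field k] [AddCommGroup V] [Module k V] (N S : Submodule k V)
    (h : Disjoint N S) : ∃ ρ : V →ₗ[k] V, (∀ x ∈ N, ρ x = 0) ∧ (∀ x ∈ S, ρ x = x) ∧ ∀ x, ρ x ∈ S := by
  obtain ⟨W, hW, hc⟩ := h.exists_isCompl
  refine ⟨S.subtype ∘ₗ S.projectionOnto W hc.symm, ?_, ?_, ?_⟩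
  · intro x hx
    simp [hW hx]
  · intro x hx
    simpa using congrArg Subtype.val (Submodule.projectionOnto_apply_left hc.symm ⟨x, hx⟩)
  · intro x; simp

theorem aux_mk (k A M : Type) [Field k] [Ring A] [Algebra k A] [FiniteDimensional k A]
    [AddCommGroup M] [Module A M] [Module k M] [IsScalarTower k A M] [Module.Finite A M] (Y J : Type) [AddCommGroup Y] [Module A Y]
    (L : Y → (Module.Dual k M →ₗ[k] (J →₀ k))) (hadd : ∀ x y, L (x + y) = L x + L y)
    (hsmul : ∀ (a : A) y (φ : Module.Dual k M), L (a • y) φ = L y (φ ∘ₗ Module.toModuleEnd k (S := A) M a)) :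
    ∃ α : Y →ₗ[A] (J →₀ M), ∀ y (φ : Module.Dual k M) j, φ (α y j) = L y φ j := by
  classical
  have : Module.Finite k M := Module.Finite.trans A M
  let b := Module.finBasis k M
  let α₀ : Y → (J →₀ M) := fun y => ∑ c, (L y (b.coord c)).mapRange (fun t => t • b c) (by simp)
  have key : ∀ y (φ : Module.Dual k M) j, φ (α₀ y j) = L y φ j := by
    intro y φ j
    have h1 : φ = ∑ c, φ (b c) • b.coord c := by
      apply b.ext; intro i
      simp
    have h2 : L y φ j = ∑ c, φ (b c) * L y (b.coord c) j := by
      have h3 := congrArg (fun φ => L y φ j) h1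
      simpa only [map_sum, map_smul, Finsupp.finsetSum_apply, Finsupp.smul_apply, smul_eq_mul]
        using h3
    rw [h2]
    simp [α₀, Finsupp.finsetSum_apply, map_sum, mul_comm]
  have hext : ∀ x y : J →₀ M, (∀ (φ : Module.Dual k M) j, φ (x j) = φ (y j)) → x = y := by
    intro x y h
    ext j
    rw [← sub_eq_zero, ← Module.forall_dual_apply_eq_zero_iff k]
    intro φ; rw [map_sub, h, sub_self]
  refine ⟨{ toFun := α₀, map_add' := ?_, map_smul' := ?_ }, key⟩
  · intro x y
    apply hext; intro φ j
    rw [key, hadd]; simp [key]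
  · intro a y
    apply hext; intro φ j
    rw [key, hsmul, ← key]; rfl

def GamOp (A M : Type) [Ring A] [AddCommGroup M] [Module A M] : Type := (Module.End A M)ᵐᵒᵖ

instance GamOp.instRing (A M : Type) [Ring A] [AddCommGroup M] [Module A M] : Ring (GamOp A M) :=
  inferInstanceAs (Ring (Module.End A M)ᵐᵒᵖ)

def GamOp.mk {A M : Type} [Ring A] [AddCommGroup M] [Module A M] (γ : Module.End A M) :
    GamOp A M := MulOpposite.op γ

def GamOp.un {A M : Type} [Ring A] [AddCommGroup M] [Module A M] (r : GamOp A M) :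
    Module.End A M := MulOpposite.unop r

abbrev HomPM (A M I : Type) [Ring A] [AddCommGroup M] [Module A M] : Type := (I →₀ M) →ₗ[A] M

abbrev DualH (k A M I : Type) [Field k] [Ring A] [Algebra k A]
    [AddCommGroup M] [Module A M] [Module k M] [IsScalarTower k A M] : Type :=
  Module.Dual k (HomPM A M I)

noncomputable instance DualH.instMod (k A M I : Type) [Field k] [Ring A] [Algebra k A]
    [AddCommGroup M] [Module A M] [Module k M] [IsScalarTower k A M] :
    Module (GamOp A M) (DualH k A M I) where
  smul r q :=
    { toFun := fun ψ => q (r.un ∘ₗ ψ)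
      map_add' := fun x y => by rw [LinearMap.comp_add, map_add]
      map_smul' := fun c x => by rw [LinearMap.comp_smul, map_smul]; rfl }
  one_smul q := rfl
  mul_smul r s q := rfl
  smul_zero r := rfl
  smul_add r x y := rfl
  add_smul r s q := by
    refine LinearMap.ext fun ψ => ?_
    change q ((r.un + s.un) ∘ₗ ψ) = q (r.un ∘ₗ ψ) + q (s.un ∘ₗ ψ)
    rw [LinearMap.add_comp, map_add]
  zero_smul q := by
    refine LinearMap.ext fun ψ => ?_
    change q ((0 : Module.End A M) ∘ₗ ψ) = 0
    rw [LinearMap.zero_comp, map_zero]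

theorem aux_art2 (k A M : Type) [Field k] [Ring A] [Algebra k A] [FiniteDimensional k A]
    [AddCommGroup M] [Module A M] [Module k M] [IsScalarTower k A M] [Module.Finite A M] :
    IsSemiprimaryRing (GamOp A M) := by
  have : Module.Finite k M := Module.Finite.trans A M
  have h1 : Module.Finite k (Module.End A M) :=
    Module.Finite.of_injective (LinearMap.restrictScalarsₗ k A M M k)
      (LinearMap.restrictScalars_injective k)
  have h2 : IsArtinianRing (Module.End A M)ᵐᵒᵖ := IsArtinianRing.of_finite k _
  have : IsArtinianRing (GamOp A M) := h2
  infer_instance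

theorem left_core (k A M : Type) [Field k] [Ring A] [Algebra k A] [FiniteDimensional k A]
    [AddCommGroup M] [Module A M] [Module k M] [IsScalarTower k A M] [Module.Finite A M] (X I : Type) [AddCommGroup X] [Module A X] (u : X →ₗ[A] (I →₀ M)) :
    ∃ e : Module.End A (I →₀ M), e * e = e ∧ e ∘ₗ u = u ∧
      ∀ γ : Module.End A (I →₀ M), γ ∘ₗ u = 0 → γ * e = γ → IsNilpotent γ := by
  classical
  have hsp := aux_art2 k A M
  have hfin : Module.Finite k M := Module.Finite.trans A M
  -- the functional attached to `φ`, `p`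
  let br : Module.Dual k M → (I →₀ M) → (DualH k A M I) := fun φ p =>
    { toFun := fun ψ => φ (ψ p)
      map_add' := fun x y => by rw [LinearMap.add_apply, map_add]
      map_smul' := fun c x => by rw [LinearMap.smul_apply, map_smul]; rfl }
  have br_smul : ∀ (r : (GamOp A M)) φ p, r • br φ p = br (φ ∘ₗ LinearMap.restrictScalars k (r.un)) p :=
    fun r φ p => rfl
  have smul_D : ∀ (r : (GamOp A M)) (q : (DualH k A M I)) (ψ : (HomPM A M I)), (r • q) ψ = q ((r.un) ∘ₗ ψ) :=
    fun r q ψ => rfl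
  let act : Module.End A (I →₀ M) → ((DualH k A M I) →ₗ[(GamOp A M)] (DualH k A M I)) := fun β =>
    { toFun := fun q =>
        { toFun := fun ψ => q (ψ ∘ₗ β)
          map_add' := fun x y => by rw [LinearMap.add_comp, map_add]
          map_smul' := fun c x => by rw [LinearMap.smul_comp, map_smul]; rfl }
      map_add' := fun x y => rfl
      map_smul' := fun r x => rfl }
  have act_br : ∀ β φ p, act β (br φ p) = br φ (β p) := fun _ _ _ => rfl
  have act_mul : ∀ β₁ β₂ q, act (β₁ * β₂) q = act β₁ (act β₂ q) := fun _ _ _ => rfl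
  have act_sub : ∀ β₁ β₂ q, act (β₁ - β₂) q = act β₁ q - act β₂ q := by
    intro β₁ β₂ q
    refine LinearMap.ext fun ψ => ?_
    change q (ψ ∘ₗ (β₁ - β₂)) = q (ψ ∘ₗ β₁) - q (ψ ∘ₗ β₂)
    rw [LinearMap.comp_sub, map_sub]
  let Q : Submodule (GamOp A M) (DualH k A M I) := Submodule.span (GamOp A M) {q | ∃ φ p, q = br φ p}
  let N : Submodule (GamOp A M) (DualH k A M I) := Submodule.span (GamOp A M) {q | ∃ φ x, q = br φ (u x)}
  have hbrQ : ∀ φ p, br φ p ∈ Q := fun φ p => Submodule.subset_span ⟨φ, p, rfl⟩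
  have hactQ : ∀ β, ∀ q ∈ Q, act β q ∈ Q := by
    intro β q hq
    have : Q ≤ Q.comap (act β) := by
      refine Submodule.span_le.2 ?_
      rintro _ ⟨φ, p, rfl⟩
      exact hbrQ φ (β p)
    exact this hq
  have hNQ : N ≤ Q := by
    refine Submodule.span_mono ?_
    rintro _ ⟨φ, x, rfl⟩
    exact ⟨φ, u x, rfl⟩
  have hsupp : ∀ q ∈ Q, ∃ s : Finset I, ∀ ψ : (HomPM A M I), (∀ i ∈ s, ψ ∘ₗ Finsupp.lsingle i = 0) → q ψ = 0 := by
    intro q hq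
    induction hq using Submodule.span_induction with
    | mem x hx =>
      obtain ⟨φ, p, rfl⟩ := hx
      refine ⟨p.support, fun ψ hψ => ?_⟩
      change φ (ψ p) = 0
      rw [← Finsupp.sum_single p, Finsupp.sum, map_sum, Finset.sum_eq_zero, map_zero]
      intro i hi
      exact LinearMap.congr_fun (hψ i hi) (p i)
    | zero => exact ⟨∅, fun _ _ => rfl⟩
    | add x y _ _ hx hy =>
      obtain ⟨s, hs⟩ := hx
      obtain ⟨t, ht⟩ := hy
      refine ⟨s ∪ t, fun ψ hψ => ?_⟩
      rw [LinearMap.add_apply, hs ψ fun i hi => hψ i (Finset.mem_union_left _ hi),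
        ht ψ fun i hi => hψ i (Finset.mem_union_right _ hi), add_zero]
    | smul r x _ hx =>
      obtain ⟨s, hs⟩ := hx
      refine ⟨s, fun ψ hψ => ?_⟩
      rw [smul_D]
      refine hs _ fun i hi => ?_
      rw [LinearMap.comp_assoc, hψ i hi, LinearMap.comp_zero]
  have hext : ∀ q ∈ Q, (∀ (γ : Module.End A M) (i : I), q (γ ∘ₗ (Finsupp.lapply i : (HomPM A M I))) = 0) → q = 0 := by
    intro q hq h
    obtain ⟨s, hs⟩ := hsupp q hq
    refine LinearMap.ext fun ψ => ?_
    have h1 := hs (ψ - ∑ i ∈ s, (ψ ∘ₗ Finsupp.lsingle i) ∘ₗ (Finsupp.lapply i : (HomPM A M I))) (by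
      intro j hj
      refine LinearMap.ext fun m => ?_
      simp only [LinearMap.comp_apply, LinearMap.sub_apply, LinearMap.sum_apply,
        LinearMap.zero_apply, Finsupp.lapply_apply, Finsupp.lsingle_apply]
      rw [Finset.sum_eq_single j]
      · simp
      · intro i _ hij
        rw [Finsupp.single_eq_of_ne hij]; simp
      · intro h; exact absurd hj h)
    rw [map_sub, map_sum, Finset.sum_eq_zero (fun i _ => h _ _), sub_zero] at h1
    exact h1
  let S : Submodule (GamOp A M) (DualH k A M I) :=
    { carrier := {q | q ∈ Q ∧ ∀ r ∈ Ring.jacobson (GamOp A M), r • q = 0}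
      zero_mem' := ⟨Q.zero_mem, fun r _ => smul_zero r⟩
      add_mem' := fun {x y} hx hy => ⟨Q.add_mem hx.1 hy.1, fun r hr => by
        rw [smul_add, hx.2 r hr, hy.2 r hr, add_zero]⟩
      smul_mem' := fun c x hx => ⟨Q.smul_mem c hx.1, fun r hr => by
        rw [← mul_smul]
        exact hx.2 _ (Ideal.mul_mem_right c _ hr)⟩ }
  have hnil : ∀ β : Module.End A (I →₀ M), (∀ q ∈ S, act β q = 0) → IsNilpotent β := by
    intro β hβ
    obtain ⟨n, hn⟩ := IsSemiprimaryRing.isNilpotent (R := GamOp A M)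
    refine ⟨n, ?_⟩
    have key : ∀ n : ℕ, ∀ q ∈ Q, (∀ r ∈ Ring.jacobson (GamOp A M) ^ n, r • q = 0) → act (β ^ n) q = 0 := by
      intro n
      induction n with
      | zero =>
        intro q hq h
        have := h 1 (by rw [Submodule.pow_zero, Ideal.one_eq_top]; trivial)
        rw [one_smul] at this
        rw [this, map_zero]
      | succ n ih =>
        intro q hq h
        rw [pow_succ, act_mul]
        refine ih _ (hactQ β q hq) fun r hr => ?_
        rw [← map_smul]
        refine hβ _ ⟨Q.smul_mem r hq, fun t ht => ?_⟩
        rw [← mul_smul]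
        refine h _ ?_
        rcases Nat.eq_zero_or_pos n with h0 | h0
        · subst h0
          rw [Submodule.pow_one]
          exact Ideal.mul_mem_right r _ ht
        · rw [Submodule.pow_succ' _ h0.ne']
          exact Ideal.mul_mem_mul ht hr
    refine LinearMap.ext fun p => Finsupp.ext fun i => ?_
    rw [LinearMap.zero_apply, Finsupp.zero_apply, ← Module.forall_dual_apply_eq_zero_iff k]
    intro φ
    have h1 := key n (br φ p) (hbrQ φ p) (by
      intro r hr
      rw [hn] at hr
      rw [(Submodule.mem_bot (GamOp A M)).1 hr, zero_smul])
    exact LinearMap.congr_fun h1 (Finsupp.lapply i : (HomPM A M I))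
  obtain ⟨S', hS'1, hS'2, hS'3⟩ := aux_compl2 (GamOp A M) (DualH k A M I) N S (fun q hq => hq.2)
  -- k-structure
  have hk : ∀ (c : k) (q : (DualH k A M I)), c • q = (GamOp.mk (c • 1 : Module.End A M) : (GamOp A M)) • q := by
    intro c q
    refine LinearMap.ext fun ψ => ?_
    rw [smul_D]
    change c • q ψ = q ((c • 1 : Module.End A M) ∘ₗ ψ)
    rw [LinearMap.smul_comp, map_smul]; rfl
  let toK : Submodule (GamOp A M) (DualH k A M I) → Submodule k (DualH k A M I) := fun T =>
    { carrier := T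
      zero_mem' := T.zero_mem
      add_mem' := fun hx hy => T.add_mem hx hy
      smul_mem' := fun c x hx => by rw [hk]; exact T.smul_mem _ hx }
  obtain ⟨ρ, hρ1, hρ2, hρ3⟩ := aux_proj k (DualH k A M I) (toK N) (toK S') (by
    rw [Submodule.disjoint_def]
    intro x h1 h2
    exact Submodule.disjoint_def.1 hS'2 x h1 h2)
  have hρQ : ∀ q, ρ q ∈ Q := fun q => (hS'1 (hρ3 q)).1
  have hlam : ∀ q : (DualH k A M I), ∃ v : I →₀ k, ∀ i, v i = ρ q (Finsupp.lapply i : (HomPM A M I)) := by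
    intro q
    obtain ⟨s, hs⟩ := hsupp _ (hρQ q)
    refine ⟨Finsupp.onFinset s (fun i => ρ q (Finsupp.lapply i : (HomPM A M I))) ?_, fun i => rfl⟩
    intro i hi
    by_contra his
    refine hi (hs _ fun j hj => ?_)
    refine LinearMap.ext fun m => ?_
    simp only [LinearMap.comp_apply, Finsupp.lapply_apply, Finsupp.lsingle_apply,
      LinearMap.zero_apply]
    exact Finsupp.single_eq_of_ne (fun h => his (h ▸ hj))
  choose lam hlam using hlam
  obtain ⟨α, hα⟩ := aux_mk k A M (I →₀ M) I (fun p =>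
    { toFun := fun φ => lam (br φ p)
      map_add' := fun x y => by
        ext i
        have : br (x + y) p = br x p + br y p := rfl
        rw [Finsupp.add_apply, hlam, hlam, hlam, this, map_add]; rfl
      map_smul' := fun c x => by
        ext i
        have : br (c • x) p = c • br x p := rfl
        rw [RingHom.id_apply, Finsupp.smul_apply, hlam, hlam, this, map_smul]; rfl })
    (by
      intro x y
      refine LinearMap.ext fun φ => Finsupp.ext fun i => ?_
      have : br φ (x + y) = br φ x + br φ y := by
        refine LinearMap.ext fun ψ => ?_
        change φ (ψ (x + y)) = φ (ψ x) + φ (ψ y)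
        rw [map_add, map_add]
      change lam (br φ (x + y)) i = lam (br φ x) i + lam (br φ y) i
      rw [hlam, hlam, hlam, this, map_add]; rfl)
    (by
      intro a y φ
      have : br φ (a • y) = br (φ ∘ₗ Module.toModuleEnd k (S := A) M a) y := by
        refine LinearMap.ext fun ψ => ?_
        change φ (ψ (a • y)) = φ (a • ψ y)
        rw [map_smul]
      change lam _ = lam _
      rw [this])
  have hα : ∀ φ p i, φ (α p i) = ρ (br φ p) (Finsupp.lapply i : (HomPM A M I)) := by
    intro φ p i
    rw [← hlam]; exact hα p φ i
  have hαQ : ∀ q ∈ Q, ∀ (γ : Module.End A M) (i : I), act α q (γ ∘ₗ (Finsupp.lapply i : (HomPM A M I))) =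
      ρ ((GamOp.mk γ : (GamOp A M)) • q) (Finsupp.lapply i : (HomPM A M I)) := by
    intro q hq
    induction hq using Submodule.span_induction with
    | mem x hx =>
      obtain ⟨φ, p, rfl⟩ := hx
      intro γ i
      rw [br_smul, ← hα]; rfl
    | zero => intro γ i; rw [smul_zero, map_zero, map_zero]; rfl
    | add x y _ _ hx hy =>
      intro γ i
      rw [smul_add, map_add, map_add, LinearMap.add_apply, LinearMap.add_apply, hx, hy]
    | smul r x _ hx =>
      intro γ i
      rw [map_smul, smul_D, ← mul_smul, ← LinearMap.comp_assoc]
      exact hx _ i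
  have hαN : ∀ q ∈ N, act α q = 0 := by
    intro q hq
    refine hext _ (hactQ α q (hNQ hq)) fun γ i => ?_
    rw [hαQ q (hNQ hq), hρ1 _ (N.smul_mem _ hq)]; rfl
  have hαS' : ∀ q ∈ S', act α q = q := by
    intro q hq
    have hqQ := (hS'1 hq).1
    rw [← sub_eq_zero]
    refine hext _ (Q.sub_mem (hactQ α q hqQ) hqQ) fun γ i => ?_
    rw [LinearMap.sub_apply, hαQ q hqQ, hρ2 _ (S'.smul_mem _ hq), sub_eq_zero]; rfl
  have hαu : α ∘ₗ u = 0 := by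
    refine LinearMap.ext fun x => Finsupp.ext fun i => ?_
    rw [LinearMap.zero_apply, Finsupp.zero_apply, ← Module.forall_dual_apply_eq_zero_iff k]
    intro φ
    exact LinearMap.congr_fun (hαN (br φ (u x)) (Submodule.subset_span ⟨φ, x, rfl⟩)) (Finsupp.lapply i : (HomPM A M I))
  have hKN : ∀ γ : Module.End A (I →₀ M), γ ∘ₗ u = 0 → ∀ q ∈ N, act γ q = 0 := by
    intro γ hγ q hq
    have : N ≤ LinearMap.ker (act γ) := by
      refine Submodule.span_le.2 ?_
      rintro _ ⟨φ, x, rfl⟩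
      change br φ ((γ ∘ₗ u) x) = 0
      rw [hγ]
      refine LinearMap.ext fun ψ => ?_
      change φ (ψ 0) = 0
      rw [map_zero, map_zero]
    exact this hq
  have hγα : ∀ γ : Module.End A (I →₀ M), γ ∘ₗ u = 0 → ∀ q ∈ S, act (γ * α) q = act γ q := by
    intro γ hγ q hq
    obtain ⟨y, hy, z, hz, rfl⟩ := Submodule.mem_sup.1 (hS'3 hq)
    rw [act_mul, map_add, hαN y hy, hαS' z hz, zero_add, map_add, hKN γ hγ y hy, zero_add]
  obtain ⟨n, e, c, he1, -, he2, -, he3⟩ := aux_idem α (hnil _ fun q hq => by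
    rw [mul_sub, mul_one, act_sub, hγα α hαu q hq, sub_self])
  refine ⟨e, he1, ?_, ?_⟩
  · rw [he2, LinearMap.sub_comp, Module.End.mul_eq_comp, LinearMap.comp_assoc, hαu,
      LinearMap.comp_zero, sub_zero]; rfl
  · intro γ h1 h2
    refine hnil γ fun q hq => ?_
    have h3 : ∀ m : ℕ, act (γ * α ^ m) q = act γ q := by
      intro m
      induction m with
      | zero => rw [pow_zero, mul_one]
      | succ m ih =>
        rw [pow_succ, ← mul_assoc]
        rw [hγα (γ * α ^ m) _ q hq, ih]
        cases m with
        | zero => rw [pow_zero, mul_one, h1]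
        | succ m =>
          rw [pow_succ, ← mul_assoc, Module.End.mul_eq_comp, LinearMap.comp_assoc, hαu,
            LinearMap.comp_zero]
    rw [← h3 n, ← h2, mul_assoc, he3, mul_zero]
    refine LinearMap.ext fun ψ => ?_
    change q (ψ ∘ₗ (0 : Module.End A (I →₀ M))) = 0
    rw [LinearMap.comp_zero, map_zero]

theorem aux_T (k A M I J : Type) [Field k] [Ring A] [Algebra k A] [FiniteDimensional k A]
    [AddCommGroup M] [Module A M] [Module k M] [IsScalarTower k A M] [Module.Finite A M]
    (T : (I → k) →ₗ[k] (J →₀ k)) :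
    ∃ TM : (I → M) →ₗ[A] (J →₀ M), ∀ y (φ : Module.Dual k M) j,
      φ (TM y j) = T (fun i => φ (y i)) j := by
  refine aux_mk k A M (I → M) J (fun y =>
    { toFun := fun φ => T (fun i => φ (y i))
      map_add' := fun φ φ' => by rw [← map_add]; rfl
      map_smul' := fun c φ => by rw [RingHom.id_apply, ← map_smul]; rfl }) ?_ ?_
  · intro x y
    refine LinearMap.ext fun φ => ?_
    change T (fun i => φ (x i + y i)) = T _ + T _
    rw [← map_add]
    congr 1
    funext i
    exact map_add _ _ _
  · intro a y φ
    rfl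

theorem aux_eq (k M : Type) [Field k] [AddCommGroup M] [Module k M] (x y : M)
    (h : ∀ φ : Module.Dual k M, φ x = φ y) : x = y := by
  rw [← sub_eq_zero, ← Module.forall_dual_apply_eq_zero_iff k]
  intro φ; rw [map_sub, h, sub_self]

theorem aux_left_exists (k A M X : Type) [Field k] [Ring A] [Algebra k A] [FiniteDimensional k A]
    [AddCommGroup M] [Module A M] [Module k M] [IsScalarTower k A M] [Module.Finite A M]
    [AddCommGroup X] [Module A X] :
    ∃ (J : Type) (u : X →ₗ[A] (J →₀ M)), ∀ φ : X →ₗ[A] M, ∃ ψ : (J →₀ M) →ₗ[A] M, ψ ∘ₗ u = φ := by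
  let I := X →ₗ[A] M
  let b := Module.Basis.ofVectorSpace k (I → k)
  obtain ⟨Θ, hΘ⟩ := aux_T k A M I _ b.repr.toLinearMap
  refine ⟨_, Θ ∘ₗ LinearMap.pi (fun i : I => i), fun i => ?_⟩
  refine ⟨Finsupp.lsum ℕ (fun j => (b j i) • (LinearMap.id : M →ₗ[A] M)), ?_⟩
  refine LinearMap.ext fun x => aux_eq k M _ _ fun φ => ?_
  set y : I → M := fun i : I => i x with hy
  have h1 : (fun i => φ (y i)) i = φ (i x) := rfl
  rw [← h1, ← b.linearCombination_repr (fun i => φ (y i))]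
  change φ (Finsupp.lsum ℕ (fun j => (b j i) • (LinearMap.id : M →ₗ[A] M)) (Θ y)) = _
  rw [Finsupp.lsum_apply, Finsupp.linearCombination_apply, Finsupp.sum, Finsupp.sum, map_sum,
    Finset.sum_apply]
  have hsub : (b.repr (fun i => φ (y i))).support ⊆ (Θ y).support := by
    intro j hj
    rw [Finsupp.mem_support_iff] at hj ⊢
    intro h0
    apply hj
    have := hΘ y φ j
    rw [h0, map_zero] at this
    exact this.symm
  symm
  rw [Finset.sum_subset hsub]
  · refine Finset.sum_congr rfl fun j _ => ?_
    have := hΘ y φ j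
    simp only [LinearMap.smul_apply, LinearMap.id_apply, map_smul, this, Pi.smul_apply, smul_eq_mul]
    exact mul_comm _ _
  · intro j _ hj
    rw [Finsupp.notMem_support_iff.1 hj]; simp

theorem aux_left_ext (k A M X P I : Type) [Field k] [Ring A] [Algebra k A] [FiniteDimensional k A]
    [AddCommGroup M] [Module A M] [Module k M] [IsScalarTower k A M] [Module.Finite A M]
    [AddCommGroup X] [Module A X] [AddCommGroup P] [Module A P] (u : X →ₗ[A] P)
    (hu : ∀ φ : X →ₗ[A] M, ∃ ψ : P →ₗ[A] M, ψ ∘ₗ u = φ) (a : X →ₗ[A] (I →₀ M)) :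
    ∃ b : P →ₗ[A] (I →₀ M), b ∘ₗ u = a := by
  choose ψ hψ using fun i => hu (Finsupp.lapply i ∘ₗ a)
  obtain ⟨r, hr⟩ := (Finsupp.lcoeFun : (I →₀ k) →ₗ[k] (I → k)).exists_leftInverse_of_injective
    (LinearMap.ker_eq_bot.2 DFunLike.coe_injective)
  obtain ⟨ρ, hρ⟩ := aux_T k A M I I r
  refine ⟨ρ ∘ₗ LinearMap.pi ψ, ?_⟩
  refine LinearMap.ext fun x => Finsupp.ext fun j => aux_eq k M _ _ fun φ => ?_
  have h1 : LinearMap.pi ψ (u x) = ⇑(a x) := by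
    funext i
    exact LinearMap.congr_fun (hψ i) x
  change φ (ρ (LinearMap.pi ψ (u x)) j) = _
  rw [h1, hρ]
  have h2 := LinearMap.congr_fun hr ((a x).mapRange φ (map_zero φ))
  have h3 : (fun i => φ (a x i)) = (Finsupp.lcoeFun : (I →₀ k) →ₗ[k] (I → k)) ((a x).mapRange φ (map_zero φ)) := by
    funext i; simp
  rw [h3]
  change (r ∘ₗ (Finsupp.lcoeFun : (I →₀ k) →ₗ[k] (I → k))) _ j = _
  rw [h2]; simp

theorem aux_memAdd (A : Type) [Ring A] (M : ModuleCat.{0} A) (I : Type)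
    (e : Module.End A (I →₀ M)) (he : e * e = e) :
    MemAddBig A M (ModuleCat.of A (LinearMap.range e)) := by
  have h : ∀ x : LinearMap.range e, e.rangeRestrict x = x := by
    rintro ⟨_, y, rfl⟩
    exact Subtype.ext (LinearMap.congr_fun he y)
  exact ⟨I, ModuleCat.of A (LinearMap.ker e.rangeRestrict),
    ⟨Submodule.prodEquivOfIsCompl _ _ (LinearMap.isCompl_of_proj h)⟩⟩

theorem aux_unit {A P : Type} [Ring A] [AddCommGroup P] [Module A P] (γ : Module.End A P)
    (h : IsNilpotent γ) : Function.Bijective (fun p => p - γ p) := by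
  have := h.isUnit_one_sub
  exact (Module.End.isUnit_iff _).1 this

theorem aux_bij {A P : Type} [Ring A] [AddCommGroup P] [Module A P] (e : Module.End A P)
    (he : e * e = e) (β : LinearMap.range e →ₗ[A] LinearMap.range e)
    (h : IsNilpotent (e - (LinearMap.range e).subtype ∘ₗ β ∘ₗ e.rangeRestrict : Module.End A P)) :
    Function.Bijective β := by
  have hb := aux_unit _ h
  have hfix : ∀ x : LinearMap.range e, e.rangeRestrict x = x := by
    rintro ⟨_, y, rfl⟩
    exact Subtype.ext (LinearMap.congr_fun he y)
  have hval : ∀ x : LinearMap.range e, (x : P) - (e - (LinearMap.range e).subtype ∘ₗ β ∘ₗ e.rangeRestrict : Module.End A P) x = β x := by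
    intro x
    have h1 : e (x : P) = x := congrArg Subtype.val (hfix x)
    simp only [LinearMap.sub_apply, LinearMap.comp_apply, hfix, h1, Submodule.subtype_apply]
    abel
  constructor
  · intro x y hxy
    apply Subtype.ext
    apply hb.1
    change (x : P) - _ = (y : P) - _
    rw [hval, hval, hxy]
  · intro y
    obtain ⟨p, hp⟩ := hb.2 (y : P)
    have hp' : p = y + (e p - β (e.rangeRestrict p)) := by rw [← hp]; simp
    have hmem : p ∈ LinearMap.range e := by
      rw [hp']
      exact Submodule.add_mem _ y.2 (Submodule.sub_mem _ ⟨p, rfl⟩ (β _).2)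
    refine ⟨⟨p, hmem⟩, Subtype.ext ?_⟩
    rw [← hval ⟨p, hmem⟩]
    exact hp

/-- **Remark 3.2(2)**. Over a finite-dimensional self-injective algebra `A` with a finitely
generated generator `M`, every `A`-module admits a minimal right `Add M`-approximation and a
minimal left `Add M`-approximation. -/
theorem exists_minimal_right_and_left_AddM_approximations
    (k A : Type) [Field k] [Ring A] [Algebra k A] [FiniteDimensional k A]
    [Module.Injective A A]
    (M : ModuleCat.{0} A) [Module.Finite A ↥M] (hgen : IsGen A M) :
    ∀ X : ModuleCat.{0} A,
      (∃ (M' : ModuleCat.{0} A) (f : M' ⟶ X), MemAddBig A M M' ∧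
        (∀ Z : ModuleCat.{0} A, MemAddBig A M Z → ∀ g : Z ⟶ X, ∃ g' : Z ⟶ M', g = g' ≫ f) ∧
        (∀ α : M' ⟶ M', α ≫ f = f → Function.Bijective α)) ∧
      (∃ (M'' : ModuleCat.{0} A) (g : X ⟶ M''), MemAddBig A M M'' ∧
        (∀ Z : ModuleCat.{0} A, MemAddBig A M Z → ∀ h : X ⟶ Z, ∃ h' : M'' ⟶ Z, h = g ≫ h') ∧
        (∀ α : M'' ⟶ M'', g ≫ α = g → Function.Bijective α)) := by
  intro X
  letI : Module k M := Module.compHom M (algebraMap k A)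
  haveI : IsScalarTower k A M := ⟨fun c a m => by
    rw [Algebra.smul_def, mul_smul]; rfl⟩
  constructor
  · let f : ((↥M →ₗ[A] ↥X) →₀ ↥M) →ₗ[A] ↥X := Finsupp.lsum ℕ (fun h => h)
    have hf : ∀ h : ↥M →ₗ[A] ↥X, f ∘ₗ Finsupp.lsingle h = h := by
      intro h
      refine LinearMap.ext fun m => ?_
      simp [f]
    obtain ⟨e, he1, he2, he3⟩ := right_core k A M X (↥M →ₗ[A] ↥X) f
    refine ⟨ModuleCat.of A (LinearMap.range e),
      ModuleCat.ofHom (f ∘ₗ (LinearMap.range e).subtype), aux_memAdd A M _ e he1, ?_, ?_⟩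
    · rintro Z ⟨I', Y, ⟨ε⟩⟩ g
      let g' : (I' →₀ ↥M) →ₗ[A] ↥X := g.hom ∘ₗ LinearMap.fst A Z Y ∘ₗ ε.symm.toLinearMap
      let l : (I' →₀ ↥M) →ₗ[A] ((↥M →ₗ[A] ↥X) →₀ ↥M) :=
        Finsupp.lsum ℕ (fun i => Finsupp.lsingle (g' ∘ₗ Finsupp.lsingle i))
      have hl : f ∘ₗ l = g' := by
        refine Finsupp.lhom_ext' fun i => ?_
        have : l ∘ₗ Finsupp.lsingle i = Finsupp.lsingle (g' ∘ₗ Finsupp.lsingle i) := by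
          refine LinearMap.ext fun m => ?_
          simp [l]
        rw [LinearMap.comp_assoc, this, hf]
      refine ⟨ModuleCat.ofHom (e.rangeRestrict ∘ₗ l ∘ₗ ε.toLinearMap ∘ₗ LinearMap.inl A Z Y), ?_⟩
      refine ModuleCat.hom_ext (LinearMap.ext fun z => ?_)
      change g.hom z = (f ∘ₗ e) (l (ε (z, 0)))
      rw [he2]
      change _ = (f ∘ₗ l) _
      rw [hl]
      simp [g']
    · intro α hα
      refine aux_bij e he1 α.hom (he3 _ ?_ ?_)
      · refine LinearMap.ext fun p => ?_
        have h1 := LinearMap.congr_fun (congrArg ModuleCat.Hom.hom hα) (e.rangeRestrict p)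
        change f (α.hom (e.rangeRestrict p)) = f (e p) at h1
        change f (e p - α.hom (e.rangeRestrict p)) = 0
        rw [map_sub, h1, sub_self]
      · rw [mul_sub, he1]
        congr 1
        refine LinearMap.ext fun p => ?_
        obtain ⟨y, hy⟩ := (α.hom (e.rangeRestrict p)).2
        change e (α.hom (e.rangeRestrict p)).1 = (α.hom (e.rangeRestrict p)).1
        rw [← hy]
        exact LinearMap.congr_fun he1 y
  · obtain ⟨J, u, hu⟩ := aux_left_exists k A M X
    obtain ⟨e, he1, he2, he3⟩ := left_core k A M X J u
    refine ⟨ModuleCat.of A (LinearMap.range e),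
      ModuleCat.ofHom (e.rangeRestrict ∘ₗ u), aux_memAdd A M _ e he1, ?_, ?_⟩
    · rintro Z ⟨I', Y, ⟨ε⟩⟩ h
      obtain ⟨b, hb⟩ := aux_left_ext k A M X _ I' u hu
        (ε.toLinearMap ∘ₗ LinearMap.inl A Z Y ∘ₗ h.hom)
      refine ⟨ModuleCat.ofHom (LinearMap.fst A Z Y ∘ₗ ε.symm.toLinearMap ∘ₗ b ∘ₗ
        (LinearMap.range e).subtype), ?_⟩
      refine ModuleCat.hom_ext (LinearMap.ext fun x => ?_)
      change h.hom x = (ε.symm (b ((e ∘ₗ u) x))).1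
      rw [he2]
      change _ = (ε.symm ((b ∘ₗ u) x)).1
      rw [hb]
      simp
    · intro α hα
      refine aux_bij e he1 α.hom (he3 _ ?_ ?_)
      · refine LinearMap.ext fun x => ?_
        have h1 := congrArg Subtype.val
          (LinearMap.congr_fun (congrArg ModuleCat.Hom.hom hα) x)
        change (α.hom (e.rangeRestrict (u x))).1 = e (u x) at h1
        change e (u x) - (α.hom (e.rangeRestrict (u x))).1 = 0
        rw [h1, sub_self]
      · rw [sub_mul, he1]
        congr 1
        refine LinearMap.ext fun p => ?_
        change (α.hom (e.rangeRestrict (e p))).1 = (α.hom (e.rangeRestrict p)).1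
        have : e.rangeRestrict (e p) = e.rangeRestrict p :=
          Subtype.ext (LinearMap.congr_fun he1 p)
        rw [this]
end

section
/- Let k be a field, A a finite-dimensional self-injective k-algebra, and M a finitely generated self-orthogonal generator for A-mod. Then the class 𝒢 is closed under filtered colimits in A-Mod: if F is a functor from a small filtered category to A-Mod all of whose values lie in 𝒢, then colim F lies in 𝒢. -/
open CategoryTheory
open Limits

set_option linter.style.haveILetI false
set_option linter.unusedSectionVars false

noncomputable section Aux

variable {A : Type} [Ring A]

lemma aux_extZero_iff (X Y : ModuleCat.{0} A) (P : ProjectiveResolution X) (n : ℕ) :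
    extZero A (n+1) X Y ↔ ∀ f : P.complex.X (n+1) ⟶ Y, P.complex.d (n+2) (n+1) ≫ f = 0 →
      ∃ g : P.complex.X n ⟶ Y, P.complex.d (n+1) n ≫ g = f := by
  unfold extZero
  rw [← ModuleCat.isZero_iff_subsingleton, (P.isoExt (R := ℤ) (n+1) Y).isZero_iff,
    ← HomologicalComplex.exactAt_iff_isZero_homology,
    HomologicalComplex.exactAt_iff' _ n (n+1) (n+2) (by simp) (by simp),
    ShortComplex.moduleCat_exact_iff]
  rfl

lemma aux_ext_iff (X Y : ModuleCat.{0} A) (n : ℕ) :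
    extZero A (n+1) X Y ↔ Subsingleton (Abelian.Ext.{0} X Y (n+1)) := by
  let P := ProjectiveResolution.of X
  rw [aux_extZero_iff X Y P]
  constructor
  · intro h
    refine subsingleton_of_forall_eq 0 fun e => ?_
    obtain ⟨f, hf, rfl⟩ := P.extMk_surjective e (n+2) rfl
    rw [P.extMk_eq_zero_iff f _ _ hf n rfl]
    exact h f hf
  · intro h f hf
    exact (P.extMk_eq_zero_iff f (n+2) rfl hf n rfl).1 (Subsingleton.elim _ _)

/-- covariant dimension shift -/
lemma aux_cov (S : ShortComplex (ModuleCat.{0} A)) (hS : S.ShortExact) [Injective S.X₂]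
    (X : ModuleCat.{0} A) (n : ℕ) :
    extZero A (n+2) X S.X₁ ↔ extZero A (n+1) X S.X₃ := by
  rw [aux_ext_iff, aux_ext_iff]
  constructor
  · intro h
    refine subsingleton_of_forall_eq 0 fun e => ?_
    obtain ⟨x, hx⟩ := Abelian.Ext.covariant_sequence_exact₃ X hS e rfl (Subsingleton.elim _ _)
    rw [← hx, Abelian.Ext.eq_zero_of_injective x]; simp
  · intro h
    refine subsingleton_of_forall_eq 0 fun e => ?_
    obtain ⟨x, hx⟩ := Abelian.Ext.covariant_sequence_exact₁ X hS e
      (Abelian.Ext.eq_zero_of_injective _) (n₀ := n+1) rfl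
    rw [← hx, Subsingleton.elim x 0]; simp

lemma aux_cov0 (S : ShortComplex (ModuleCat.{0} A)) (hS : S.ShortExact) [Injective S.X₂]
    (X : ModuleCat.{0} A) :
    extZero A 1 X S.X₁ ↔ ∀ u : X ⟶ S.X₃, ∃ v : X ⟶ S.X₂, v ≫ S.g = u := by
  rw [aux_ext_iff]
  constructor
  · intro h u
    obtain ⟨x, hx⟩ := Abelian.Ext.covariant_sequence_exact₃ X hS (Abelian.Ext.mk₀ u) rfl
      (Subsingleton.elim _ _)
    obtain ⟨v, rfl⟩ := Abelian.Ext.homEquiv₀.symm.surjective x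
    refine ⟨v, Abelian.Ext.homEquiv₀.symm.injective ?_⟩
    simpa using hx
  · intro h
    refine subsingleton_of_forall_eq 0 fun e => ?_
    obtain ⟨x, hx⟩ := Abelian.Ext.covariant_sequence_exact₁ X hS e
      (Abelian.Ext.eq_zero_of_injective _) (n₀ := 0) rfl
    obtain ⟨u, rfl⟩ := Abelian.Ext.homEquiv₀.symm.surjective x
    obtain ⟨v, rfl⟩ := h u
    rw [← hx]
    change (Abelian.Ext.mk₀ (v ≫ S.g)).comp hS.extClass _ = 0
    rw [← Abelian.Ext.mk₀_comp_mk₀_assoc, hS.comp_extClass, Abelian.Ext.comp_zero]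

/-- contravariant dimension shift -/
lemma aux_contra (S : ShortComplex (ModuleCat.{0} A)) (hS : S.ShortExact) [Projective S.X₂]
    (X : ModuleCat.{0} A) (n : ℕ) :
    extZero A (n+2) S.X₃ X ↔ extZero A (n+1) S.X₁ X := by
  rw [aux_ext_iff, aux_ext_iff]
  constructor
  · intro h
    refine subsingleton_of_forall_eq 0 fun e => ?_
    obtain ⟨x, hx⟩ := Abelian.Ext.contravariant_sequence_exact₁ hS X e (n₁ := n+2) (by omega)
      (Subsingleton.elim _ _)
    rw [← hx, Abelian.Ext.eq_zero_of_projective x]; simp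
  · intro h
    refine subsingleton_of_forall_eq 0 fun e => ?_
    obtain ⟨x, hx⟩ := Abelian.Ext.contravariant_sequence_exact₃ hS X e
      (Abelian.Ext.eq_zero_of_projective _) (n₀ := n+1) (by omega)
    rw [← hx, Subsingleton.elim x 0]; simp

lemma aux_contra0 (S : ShortComplex (ModuleCat.{0} A)) (hS : S.ShortExact) [Projective S.X₂]
    (X : ModuleCat.{0} A) :
    extZero A 1 S.X₃ X ↔ ∀ u : S.X₁ ⟶ X, ∃ v : S.X₂ ⟶ X, S.f ≫ v = u := by
  rw [aux_ext_iff]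
  constructor
  · intro h u
    obtain ⟨x, hx⟩ := Abelian.Ext.contravariant_sequence_exact₁ hS X (Abelian.Ext.mk₀ u)
      (n₁ := 1) (by omega) (Subsingleton.elim _ _)
    obtain ⟨v, rfl⟩ := Abelian.Ext.homEquiv₀.symm.surjective x
    refine ⟨v, Abelian.Ext.homEquiv₀.symm.injective ?_⟩
    simpa using hx
  · intro h
    refine subsingleton_of_forall_eq 0 fun e => ?_
    obtain ⟨x, hx⟩ := Abelian.Ext.contravariant_sequence_exact₃ hS X e
      (Abelian.Ext.eq_zero_of_projective _) (n₀ := 0) (by omega)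
    obtain ⟨u, rfl⟩ := Abelian.Ext.homEquiv₀.symm.surjective x
    obtain ⟨v, rfl⟩ := h u
    rw [← hx]
    change hS.extClass.comp (Abelian.Ext.mk₀ (S.f ≫ v)) _ = 0
    rw [← Abelian.Ext.mk₀_comp_mk₀, hS.extClass_comp_assoc]


lemma aux_se {K M : Type} [AddCommGroup K] [Module A K] [AddCommGroup M] [Module A M]
    (p : K →ₗ[A] M) (hp : Function.Surjective p) :
    (ShortComplex.mk
      (ModuleCat.ofHom (LinearMap.ker p).subtype) (ModuleCat.ofHom p)
      (by ext x; exact x.2) : ShortComplex (ModuleCat.{0} A)).ShortExact where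
  exact := by
    rw [ShortComplex.moduleCat_exact_iff]
    intro x hx
    exact ⟨⟨x, hx⟩, rfl⟩
  mono_f := (ModuleCat.mono_iff_injective _).2 Subtype.val_injective
  epi_g := (ModuleCat.epi_iff_surjective _).2 hp

lemma aux_proj_s12 (m : ℕ) : Projective (ModuleCat.of A (Fin m → A)) :=
  (IsProjective.iff_projective _).1 inferInstance

lemma aux_coext (k : Type) [Field k] [Algebra k A] [FiniteDimensional k A]
    (M : ModuleCat.{0} A) [Module.Finite A M] :
    ∃ S : ShortComplex (ModuleCat.{0} A), S.ShortExact ∧ S.X₁ = M ∧ Injective S.X₂ ∧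
      Module.Finite A S.X₂ ∧ Module.Finite A S.X₃ := by
  let f := algebraMap k A
  let V := (ModuleCat.restrictScalars f).obj M
  let I : ModuleCat.{0} A := (ModuleCat.coextendScalars f).obj V
  let i : M ⟶ I := (ModuleCat.restrictCoextendScalarsAdj f).unit.app M
  have hi : Function.Injective i := by
    intro x y h
    have h' := congrArg (fun g => ModuleCat.CoextendScalars.equiv f V g (1 : A)) h
    change (1 : A) • x = (1 : A) • y at h'
    simpa using h'
  haveI : Mono i := (ModuleCat.mono_iff_injective _).2 hi
  haveI : Injective V := by
    haveI : Module.Injective k V := Module.injective_of_isSemisimpleRing _ _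
    exact Module.injective_object_of_injective_module k V
  haveI : Injective I := Injective.injective_of_adjoint (ModuleCat.restrictCoextendScalarsAdj f) V
  haveI hVf : Module.Finite k V := by
    letI : Module k M := Module.compHom M f
    haveI : IsScalarTower k A M := ⟨fun a b x => by
      rw [Algebra.smul_def, mul_smul]; rfl⟩
    exact (Module.Finite.trans A M : Module.Finite k M)
  haveI hAf : Module.Finite k ((ModuleCat.restrictScalars f).obj (ModuleCat.of A A)) := by
    have : Algebra.toModule = Module.compHom A f := by
      ext r x; exact Algebra.smul_def r x
    have h2 : Module.Finite k A := inferInstance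
    rw [this] at h2
    exact h2
  haveI hIf : Module.Finite A I := by
    let W := ((ModuleCat.restrictScalars f).obj (ModuleCat.of A A) →ₗ[k] V)
    have hW : Module.Finite k W := inferInstance
    obtain ⟨T, hT⟩ := hW
    let toI : W → I := fun w => w
    have hsm : ∀ (r : k) (y : W), toI (r • y) = f r • toI y := by
      intro r y
      refine LinearMap.ext (f := (r • y : W)) (g := (show W from (f r • toI y : I))) ?_
      intro (a : A)
      change r • y a = y (a * f r)
      have h1 := LinearMap.map_smul y r a
      have h2 : y (f r * a) = y (a * f r) := congrArg y (Algebra.commutes r a)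
      exact h1.symm.trans h2
    refine ⟨Submodule.fg_def.2 ⟨toI '' (T : Set W), T.finite_toSet.image _, top_le_iff.1 ?_⟩⟩
    have key : ∀ w : W, w ∈ Submodule.span k (T : Set W) →
        toI w ∈ Submodule.span A (toI '' (T : Set W)) := by
      intro w hw
      induction hw using Submodule.span_induction with
      | mem y hy => exact Submodule.subset_span ⟨y, hy, rfl⟩
      | zero => exact Submodule.zero_mem _
      | add y z _ _ h1 h2 => exact Submodule.add_mem _ h1 h2
      | smul r y _ h1 =>
        rw [hsm]
        exact Submodule.smul_mem _ _ h1
    intro x _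
    exact key x (by rw [hT]; trivial)
  refine ⟨ShortComplex.mk i (ModuleCat.ofHom (LinearMap.range i.hom).mkQ)
    (by ext x; exact (Submodule.Quotient.mk_eq_zero _).2 ⟨x, rfl⟩), ?_, rfl, inferInstance,
    hIf, (inferInstance : Module.Finite A (I ⧸ LinearMap.range i.hom))⟩
  exact
    { exact := by
        rw [ShortComplex.moduleCat_exact_iff]
        intro x hx
        exact (Submodule.Quotient.mk_eq_zero _).1 hx
      mono_f := inferInstance
      epi_g := (ModuleCat.epi_iff_surjective _).2 (Submodule.mkQ_surjective _) }

section Directed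

variable {α : Type} [PartialOrder α] [IsDirected α (· ≤ ·)] [Nonempty α]
  (G : α ⥤ ModuleCat.{0} A) (c : Cocone G) (hc : IsColimit c)

include hc in
lemma aux_rep (x : c.pt) : ∃ (j : α) (y : G.obj j), c.ι.app j y = x :=
  Concrete.isColimit_exists_rep G hc x

include hc in
lemma aux_eq_s12 {i j : α} (x : G.obj i) (y : G.obj j) (h : c.ι.app i x = c.ι.app j y) :
    ∃ (l : α) (h₁ : i ≤ l) (h₂ : j ≤ l), G.map (homOfLE h₁) x = G.map (homOfLE h₂) y := by
  obtain ⟨l, f, g, e⟩ := Concrete.isColimit_exists_of_rep_eq G hc x y h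
  exact ⟨l, leOfHom f, leOfHom g, e⟩

lemma aux_w {i j : α} (h : i ≤ j) (x : G.obj i) :
    c.ι.app j (G.map (homOfLE h) x) = c.ι.app i x := by
  rw [← c.w (homOfLE h)]; rfl

lemma aux_map_s12 {i j l : α} (h : i ≤ j) (h' : j ≤ l) (x : G.obj i) :
    G.map (homOfLE h') (G.map (homOfLE h) x) = G.map (homOfLE (h.trans h')) x := by
  have : homOfLE (h.trans h') = homOfLE h ≫ homOfLE h' := rfl
  rw [this, G.map_comp]; rfl

include hc in
lemma aux_factor (K : ModuleCat.{0} A) [Module.FinitePresentation A K] (f : K ⟶ c.pt) :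
    ∃ (j : α) (g : K ⟶ G.obj j), g ≫ c.ι.app j = f := by
  obtain ⟨n, p, hp⟩ := Module.Finite.exists_fin' A K
  obtain ⟨T, hT⟩ := Module.FinitePresentation.fg_ker p hp
  let b := Pi.basisFun A (Fin n)
  choose ji r hr using fun i => aux_rep G c hc (f (p (b i)))
  obtain ⟨j0, hj0⟩ := Finite.exists_le ji
  let h : (Fin n → A) →ₗ[A] G.obj j0 := b.constr ℕ fun i => G.map (homOfLE (hj0 i)) (r i)
  have hh : (c.ι.app j0).hom ∘ₗ h = f.hom ∘ₗ p := by
    refine b.ext fun i => ?_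
    simp only [LinearMap.comp_apply, h, Module.Basis.constr_basis]
    rw [← hr]
    exact aux_w G c (hj0 i) (r i)
  have ht : ∀ t : T, ∃ (l : α) (hl : j0 ≤ l), G.map (homOfLE hl) (h t) = 0 := by
    intro t
    have h0 : p t = 0 := by
      have : (t : Fin n → A) ∈ LinearMap.ker p := hT ▸ Submodule.subset_span t.2
      exact this
    have h1 : c.ι.app j0 (h t) = c.ι.app j0 0 := by
      have := LinearMap.congr_fun hh t
      simp only [LinearMap.comp_apply, h0, map_zero] at this
      rw [map_zero]; exact this
    obtain ⟨l, h₁, h₂, e⟩ := aux_eq_s12 G c hc _ _ h1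
    exact ⟨l, h₁, by rw [e, map_zero]⟩
  choose l hl hl0 using ht
  obtain ⟨j1', hj1'⟩ := Finite.exists_le l
  obtain ⟨j1, h01, h11⟩ := exists_ge_ge j0 j1'
  let h' : (Fin n → A) →ₗ[A] G.obj j1 := (G.map (homOfLE h01)).hom ∘ₗ h
  have hker : LinearMap.ker p ≤ LinearMap.ker h' := by
    rw [← hT, Submodule.span_le]
    intro t ht
    change G.map (homOfLE h01) (h t) = 0
    have := aux_map_s12 G (hl ⟨t, ht⟩) ((hj1' ⟨t, ht⟩).trans h11) (h t)
    rw [← this, hl0, map_zero]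
  have hp' : LinearMap.range p = ⊤ := LinearMap.range_eq_top.2 hp
  let e := p.quotKerEquivOfSurjective hp
  let g : K →ₗ[A] G.obj j1 := (LinearMap.ker p).liftQ h' hker ∘ₗ e.symm.toLinearMap
  have hg : ∀ x, g (p x) = h' x := by
    intro x
    have : e.symm (p x) = Submodule.Quotient.mk x := by
      rw [LinearEquiv.symm_apply_eq]; rfl
    simp [g, this]
  refine ⟨j1, ModuleCat.ofHom g, ?_⟩
  ext x
  obtain ⟨x, rfl⟩ := hp x
  change c.ι.app j1 (g (p x)) = _
  rw [hg]
  exact (aux_w G c h01 (h x)).trans (LinearMap.congr_fun hh x)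

section Lam

variable {k : Type} [Field k]

variable (k α) in
lemma aux_lam : ∃ l : (α → k) →ₗ[k] k, l (fun _ => 1) = 1 ∧
    ∀ h : α → k, (∀ᶠ j in Filter.atTop, h j = 0) → l h = 0 := by
  let N : Submodule k (α → k) :=
    { carrier := {h | ∀ᶠ j in Filter.atTop, h j = 0}
      add_mem' := by
        intro a b ha hb
        filter_upwards [ha, hb] with j h1 h2
        simp [h1, h2]
      zero_mem' := Filter.Eventually.of_forall fun _ => rfl
      smul_mem' := by
        intro r a ha
        filter_upwards [ha] with j h1
        simp [h1] }
  have h1 : (fun _ => 1 : α → k) ∉ N := by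
    intro h
    obtain ⟨j, hj⟩ := Filter.Eventually.exists (f := Filter.atTop) h
    exact one_ne_zero hj
  obtain ⟨l, hl, hN⟩ := Submodule.exists_le_ker_of_notMem h1
  refine ⟨(l (fun _ => 1))⁻¹ • l, by simp [hl], fun h hh => ?_⟩
  have : l h = 0 := hN hh
  simp [this]

variable (l : (α → k) →ₗ[k] k)

def auxLam (V : Type) [AddCommGroup V] [Module k V] [FiniteDimensional k V] (h : α → V) : V :=
  ∑ i, l (fun j => (Module.finBasis k V).coord i (h j)) • Module.finBasis k V i

variable {V W : Type} [AddCommGroup V] [Module k V] [FiniteDimensional k V]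
  [AddCommGroup W] [Module k W] [FiniteDimensional k W]

lemma auxLam_dual (φ : V →ₗ[k] k) (h : α → V) :
    φ (auxLam l V h) = l (fun j => φ (h j)) := by
  have : (fun j => φ (h j)) = ∑ i, φ (Module.finBasis k V i) •
      (fun j => (Module.finBasis k V).coord i (h j)) := by
    ext j
    conv_lhs => rw [← (Module.finBasis k V).sum_repr (h j), map_sum]
    simp [mul_comm]
  rw [this]
  simp [auxLam, mul_comm]

lemma auxLam_ext {v w : V} (h : ∀ φ : V →ₗ[k] k, φ v = φ w) : v = w := by
  rw [← sub_eq_zero, ← Module.forall_dual_apply_eq_zero_iff k]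
  intro φ
  rw [map_sub, h, sub_self]

lemma auxLam_nat (T : V →ₗ[k] W) (h : α → V) :
    auxLam l W (fun j => T (h j)) = T (auxLam l V h) := by
  refine auxLam_ext (k := k) fun ψ => ?_
  rw [auxLam_dual, ← LinearMap.comp_apply ψ T, auxLam_dual]
  rfl

lemma auxLam_add (h h' : α → V) :
    auxLam l V (fun j => h j + h' j) = auxLam l V h + auxLam l V h' := by
  refine auxLam_ext (k := k) fun ψ => ?_
  simp only [auxLam_dual, map_add]
  rw [← map_add]; rfl

variable (hl1 : l (fun _ => 1) = 1) (hl : ∀ h : α → k, (∀ᶠ j in Filter.atTop, h j = 0) → l h = 0)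

include hl in
lemma auxLam_congr (h h' : α → V) (e : ∀ᶠ j in Filter.atTop, h j = h' j) :
    auxLam l V h = auxLam l V h' := by
  refine auxLam_ext (k := k) fun ψ => ?_
  rw [auxLam_dual, auxLam_dual, ← sub_eq_zero, ← map_sub]
  apply hl
  filter_upwards [e] with j hj
  simp [hj]

include hl1 in
lemma auxLam_const (v : V) : auxLam l V (fun _ => v) = v := by
  refine auxLam_ext (k := k) fun ψ => ?_
  rw [auxLam_dual]
  have : (fun _ => ψ v : α → k) = ψ v • (fun _ => 1) := by ext; simp
  rw [this, map_smul, hl1]; simp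

end Lam

variable (k : Type) [Field k] [Algebra k A] [FiniteDimensional k A]

include k hc in
lemma aux_lift (I C : ModuleCat.{0} A) [Module.Finite A I] [Module.Finite A C] (π : I ⟶ C)
    (H : ∀ (j : α) (u : G.obj j ⟶ C), ∃ v : G.obj j ⟶ I, v ≫ π = u) (u : c.pt ⟶ C) :
    ∃ v : c.pt ⟶ I, v ≫ π = u := by
  classical
  letI : Module k I := Module.compHom I (algebraMap k A)
  letI : Module k C := Module.compHom C (algebraMap k A)
  haveI : IsScalarTower k A I := ⟨fun a b x => by
    rw [Algebra.smul_def, mul_smul]; rfl⟩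
  haveI : IsScalarTower k A C := ⟨fun a b x => by
    rw [Algebra.smul_def, mul_smul]; rfl⟩
  haveI : FiniteDimensional k I := Module.Finite.trans A I
  haveI : FiniteDimensional k C := Module.Finite.trans A C
  obtain ⟨l, hl1, hl⟩ := aux_lam α k
  choose v hv using fun j => H j (c.ι.app j ≫ u)
  choose jx r hr using aux_rep G c hc
  let s : c.pt → (j : α) → G.obj j := fun x j =>
    if h : jx x ≤ j then G.map (homOfLE h) (r x) else 0
  have hs : ∀ x j (h : jx x ≤ j), s x j = G.map (homOfLE h) (r x) := fun x j h => dif_pos h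
  have hs1 : ∀ x j, jx x ≤ j → c.ι.app j (s x j) = x := by
    intro x j h
    rw [hs x j h, aux_w, hr]
  have hs2 : ∀ x j j' (h : jx x ≤ j) (h' : j ≤ j'), G.map (homOfLE h') (s x j) = s x j' := by
    intro x j j' h h'
    rw [hs x j h, hs x j' (h.trans h'), aux_map_s12]
  have hadd : ∀ x y, ∀ᶠ j in Filter.atTop, s (x + y) j = s x j + s y j := by
    intro x y
    obtain ⟨j0, hx, hy⟩ := exists_ge_ge (jx x) (jx y)
    obtain ⟨j1, h01, hxy⟩ := exists_ge_ge j0 (jx (x + y))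
    have hx := hx.trans h01
    have hy := hy.trans h01
    obtain ⟨j2, h2, h2', e⟩ := aux_eq_s12 G c hc (s (x+y) j1) (s x j1 + s y j1) (by
      rw [map_add, hs1 _ _ hx, hs1 _ _ hy, hs1 _ _ hxy])
    filter_upwards [Filter.eventually_ge_atTop j2] with j hj
    have e := congrArg (G.map (homOfLE hj)) e
    rw [aux_map_s12, aux_map_s12, map_add, hs2 _ _ _ hx, hs2 _ _ _ hy, hs2 _ _ _ hxy] at e
    exact e
  have hsmul : ∀ (a : A) x, ∀ᶠ j in Filter.atTop, s (a • x) j = a • s x j := by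
    intro a x
    obtain ⟨j1, hx, hax⟩ := exists_ge_ge (jx x) (jx (a • x))
    obtain ⟨j2, h2, h2', e⟩ := aux_eq_s12 G c hc (s (a • x) j1) (a • s x j1) (by
      rw [map_smul, hs1 _ _ hx, hs1 _ _ hax])
    filter_upwards [Filter.eventually_ge_atTop j2] with j hj
    have e := congrArg (G.map (homOfLE hj)) e
    rw [aux_map_s12, aux_map_s12, map_smul, hs2 _ _ _ hx, hs2 _ _ _ hax] at e
    exact e
  let g : c.pt →ₗ[A] I :=
    { toFun := fun x => auxLam l I (fun j => v j (s x j))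
      map_add' := by
        intro x y
        rw [← auxLam_add]
        apply auxLam_congr l hl
        filter_upwards [hadd x y] with j hj
        rw [hj, map_add]
      map_smul' := by
        intro a x
        let T : I →ₗ[k] I :=
          { toFun := fun y => a • y
            map_add' := smul_add a
            map_smul' := by
              intro r y
              change a • (algebraMap k A r • y) = algebraMap k A r • (a • y)
              rw [← mul_smul, ← mul_smul, Algebra.commutes] }
        have := auxLam_nat l T (fun j => v j (s x j))
        refine Eq.trans ?_ this
        apply auxLam_congr l hl
        filter_upwards [hsmul a x] with j hj
        rw [hj, map_smul]; rfl }
  refine ⟨ModuleCat.ofHom g, ?_⟩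
  ext x
  let T : I →ₗ[k] C :=
    { toFun := fun y => π y
      map_add' := map_add π.hom
      map_smul' := by
        intro r y
        exact map_smul π.hom (algebraMap k A r) y }
  change T (auxLam l I (fun j => v j (s x j))) = u x
  rw [← auxLam_nat, ← auxLam_const l hl1 (u x)]
  apply auxLam_congr l hl
  filter_upwards [Filter.eventually_ge_atTop (jx x)] with j hj
  have e := congrArg (fun q => q.hom (s x j)) (hv j)
  change π (v j (s x j)) = u (c.ι.app j (s x j)) at e
  rw [hs1 _ _ hj] at e
  exact e



include hc in
lemma aux_part1 [IsNoetherianRing A] (n : ℕ) : ∀ (M : ModuleCat.{0} A) [Module.Finite A M],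
    (∀ j, extZero A (n+1) M (G.obj j)) → extZero A (n+1) M c.pt := by
  induction n with
  | zero =>
    intro M _ h
    obtain ⟨m, p, hp⟩ := Module.Finite.exists_fin' A M
    let S : ShortComplex (ModuleCat.{0} A) := ShortComplex.mk
      (ModuleCat.ofHom (LinearMap.ker p).subtype) (ModuleCat.ofHom p) (by ext x; exact x.2)
    have hS : S.ShortExact := aux_se _ hp
    haveI : Projective S.X₂ := aux_proj_s12 m
    haveI : Module.FinitePresentation A S.X₁ :=
      (Module.finitePresentation_iff_finite A _).2 (inferInstanceAs (Module.Finite A (LinearMap.ker p)))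
    refine (aux_contra0 S hS _).2 fun u => ?_
    obtain ⟨j, g, rfl⟩ := aux_factor G c hc S.X₁ u
    obtain ⟨v, hv⟩ := (aux_contra0 S hS _).1 (h j) g
    exact ⟨v ≫ c.ι.app j, by rw [← Category.assoc, hv]⟩
  | succ n ih =>
    intro M _ h
    obtain ⟨m, p, hp⟩ := Module.Finite.exists_fin' A M
    let S : ShortComplex (ModuleCat.{0} A) := ShortComplex.mk
      (ModuleCat.ofHom (LinearMap.ker p).subtype) (ModuleCat.ofHom p) (by ext x; exact x.2)
    have hS : S.ShortExact := aux_se _ hp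
    haveI : Projective S.X₂ := aux_proj_s12 m
    haveI : Module.Finite A S.X₁ := inferInstanceAs (Module.Finite A (LinearMap.ker p))
    exact (aux_contra S hS _ n).2 (ih _ fun j => (aux_contra S hS _ n).1 (h j))

include k hc in
lemma aux_part2 (n : ℕ) : ∀ (M : ModuleCat.{0} A) [Module.Finite A M],
    (∀ j, extZero A (n+1) (G.obj j) M) → extZero A (n+1) c.pt M := by
  induction n with
  | zero =>
    intro M _ h
    obtain ⟨S, hS, rfl, hI, h2, h3⟩ := aux_coext k M
    exact (aux_cov0 S hS _).2 (aux_lift G c hc k _ _ S.g fun j => (aux_cov0 S hS _).1 (h j))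
  | succ n ih =>
    intro M _ h
    obtain ⟨S, hS, rfl, hI, h2, h3⟩ := aux_coext k M
    exact (aux_cov S hS _ n).2 (ih _ fun j => (aux_cov S hS _ n).1 (h j))

end Directed

end Aux

open Limits in
/-- The `M`-Gorenstein subcategory `𝒢` is closed under filtered colimits in `A`-Mod. -/
theorem memG_closed_under_filtered_colimits
    (k A : Type) [Field k] [Ring A] [Algebra k A] [FiniteDimensional k A]
    [Module.Injective A A]
    (M : ModuleCat.{0} A) [Module.Finite A ↥M]
    (hgen : IsGen A M) (hso : SelfOrthogonal A M)
    (J : Type) [SmallCategory J] [IsFiltered J] (F : J ⥤ ModuleCat.{0} A)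
    (hF : ∀ j : J, MemG A M (F.obj j)) :
    MemG A M (colimit F) := by
  obtain ⟨α, _, _, _, Q, _⟩ := IsFiltered.exists_directed J
  haveI : IsNoetherianRing A := isNoetherian_of_tower k (inferInstance : IsNoetherian k A)
  let c : Cocone (Q ⋙ F) := (colimit.cocone F).whisker Q
  have hc : IsColimit c := (Functor.Final.isColimitWhiskerEquiv Q _).symm (colimit.isColimit F)
  rintro (_ | n) hn
  · omega
  exact ⟨aux_part1 (Q ⋙ F) c hc n M fun j => (hF (Q.obj j) _ hn).1,
    aux_part2 (Q ⋙ F) c hc k n M fun j => (hF (Q.obj j) _ hn).2⟩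
end
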